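/- arXiv:1609.09096 — 2 statements merged into one kernel-verified Lean document; each statement's English description precedes it below -/
import Mathlib

section
/- Real HCIZ integral as a multivariate Bessel function: for reals a_1 > ⋯ > a_m > 0 and any b ∈ ℝ^m, ∫_{O(m)} e^{−Tr(V a V^T b)/2} dHaar_V = B^{m,m}_1(a, −b/2), where a and b are regarded as m×m diagonal matrices, dHaar_V is the Haar probability measure on the orthogonal group O(m), and B^{m,m}_1 is the multivariate Bessel function with β = 1 (θ = 1/2). -/
open MeasureTheory ProbabilityTheory Filter Finset
open scoped ENNReal NNReal BigOperators Classical

noncomputable section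

namespace RMT

/-- `Δ(x) = ∏_{i<j<k} (x i - x j)`. -/
def vand (k : ℕ) (x : ℕ → ℝ) : ℝ :=
  ∏ i ∈ range k, ∏ j ∈ range k, if i < j then x i - x j else 1

/-- `Δ^trig(x) = ∏_{i<j<k} (e^{(x i - x j)/2} - e^{(x j - x i)/2})`. -/
def vandTrig (k : ℕ) (x : ℕ → ℝ) : ℝ :=
  ∏ i ∈ range k, ∏ j ∈ range k,
    if i < j then Real.exp ((x i - x j) / 2) - Real.exp ((x j - x i) / 2) else 1

/-- `Δ(x, y) = ∏_{i<a, j<b} |x i - y j|`. -/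
def cross (a b : ℕ) (x y : ℕ → ℝ) : ℝ :=
  ∏ i ∈ range a, ∏ j ∈ range b, |x i - y j|

/-- `|x| = ∑_{i<k} x i`. -/
def asum (k : ℕ) (x : ℕ → ℝ) : ℝ := ∑ i ∈ range k, x i

/-- `x` (of length `a`) interlaces `y` (of length `b`), `a ∈ {b-1, b}`:
`y 0 ≥ x 0 ≥ y 1 ≥ x 1 ≥ ⋯` (0-based). -/
def interlaces (a b : ℕ) (x y : ℕ → ℝ) : Prop :=
  (∀ i, i < a → x i ≤ y i) ∧ ∀ i, i < a → i + 1 < b → y (i + 1) ≤ x i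

/-- `x` is decreasing on its first `k` entries. -/
def decrOn (k : ℕ) (x : ℕ → ℝ) : Prop := ∀ i j, i ≤ j → j < k → x j ≤ x i

/-- strictly decreasing and positive on the first `k` entries -/
def sdecrPos (k : ℕ) (x : ℕ → ℝ) : Prop :=
  (∀ i j, i < j → j < k → x j < x i) ∧ ∀ i, i < k → 0 < x i

/-- Coordinates of a `k`-level triangular array capped at width `n`:
level `l` (0-based) has `min (l+1) n` entries. -/
def coords (k n : ℕ) : Finset (ℕ × ℕ) :=
  (range k ×ˢ range n).filter fun p => p.2 < min (p.1 + 1) n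

/-- The space of `k`-level arrays capped at width `n`. -/
abbrev Arr (k n : ℕ) : Type := { p // p ∈ coords k n } → ℝ

/-- Entry accessor, `0` outside the allowed coordinates. -/
def ent {k n : ℕ} (μ : Arr k n) (l i : ℕ) : ℝ :=
  if h : (l, i) ∈ coords k n then μ ⟨(l, i), h⟩ else 0

/-- Level `l` (1-based) of an `m`-level array; level `0` is the zero sequence. -/
def lev {m n : ℕ} (μ : Arr m n) (l : ℕ) : ℕ → ℝ :=
  fun i => if l = 0 then 0 else ent μ (l - 1) i

/-- Level `l` (1-based) of a Gelfand–Tsetlin pattern with interior `μ`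
(levels `1, …, m-1`) and prescribed top level `lam` (level `m`). -/
def levT {m n : ℕ} (μ : Arr (m - 1) n) (lam : ℕ → ℝ) (l : ℕ) : ℕ → ℝ :=
  fun i => if l = 0 then 0 else if l = m then lam i else ent μ (l - 1) i

/-- The Gelfand–Tsetlin polytope `GT_lam^{(m)}` (interior coordinates). -/
def GTset (m n : ℕ) (lam : ℕ → ℝ) : Set (Arr (m - 1) n) :=
  {μ | ∀ l, 1 ≤ l → l < m →
    interlaces (min l n) (min (l + 1) n) (levT μ lam l) (levT μ lam (l + 1))}

/-- extension of a finite vector by zero -/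
def extF {k : ℕ} (x : Fin k → ℝ) : ℕ → ℝ := fun i => if h : i < k then x ⟨i, h⟩ else 0

/-! ### Multivariate Bessel functions -/

/-- The integral `φ^{n,m}_θ(λ, s)`. -/
def phiB (θ : ℝ) (n m : ℕ) (lam s : ℕ → ℝ) : ℝ :=
  (Real.Gamma θ)⁻¹ ^ (n * (n - 1) / 2 + n * (m - n)) *
    ∫ μ in GTset m n lam,
      (Real.exp (∑ l ∈ Icc 1 m,
          s (l - 1) * (asum (min l n) (levT μ lam l) - asum (min (l - 1) n) (levT μ lam (l - 1)))) *
        ∏ i ∈ range n, levT μ lam n i ^ (θ - 1) / lam i ^ (θ - 1)) *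
      ∏ l ∈ Ico 1 m,
        cross (min l n) (min (l + 1) n) (levT μ lam l) (levT μ lam (l + 1)) ^ (θ - 1) /
          (vand (min l n) (levT μ lam l) ^ (θ - 1) *
            vand (min (l + 1) n) (levT μ lam (l + 1)) ^ (θ - 1))

/-- `Γ(mθ)Γ((m-1)θ)⋯Γ((m-n+1)θ)` -/
def gammaProd (θ : ℝ) (n m : ℕ) : ℝ := ∏ k ∈ Icc (m - n + 1) m, Real.Gamma (k * θ)

/-- The multivariate Bessel function `B^{n,m}_β(λ, s)`, `θ = β/2`. -/
def mvBessel (θ : ℝ) (n m : ℕ) (lam s : ℕ → ℝ) : ℝ :=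
  gammaProd θ n m / Real.Gamma θ ^ n *
    (phiB θ n m lam s / (vand n lam ^ θ * ∏ i ∈ range n, lam i ^ (θ * ((m - n : ℕ) : ℝ))))

/-- The conjugate multivariate Bessel function `B̃^{n,m}_β(λ, s)`. -/
def mvBesselC (θ : ℝ) (n m : ℕ) (lam s : ℕ → ℝ) : ℝ :=
  (Real.Gamma θ)⁻¹ ^ n * (∏ i ∈ range n, lam i ^ (θ - 1)) * mvBessel θ n m lam s

/-! ### Heckman–Opdam hypergeometric functions -/

/-- The integral `Φ^{n,m}_θ(λ, s)`. -/
def phiHO (θ : ℝ) (n m : ℕ) (lam s : ℕ → ℝ) : ℝ :=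
  (Real.Gamma θ)⁻¹ ^ (n * (m - n) + n * (n - 1) / 2) *
    ∫ μ in GTset m n lam,
      (Real.exp (∑ l ∈ Icc 1 m,
          s (l - 1) * (asum (min l n) (levT μ lam l) - asum (min (l - 1) n) (levT μ lam (l - 1)))) *
        ∏ i ∈ range n,
          (1 - Real.exp (-levT μ lam n i)) ^ (θ - 1) / (1 - Real.exp (-lam i)) ^ (θ - 1)) *
      ∏ l ∈ Ico 1 m,
        cross (min l n) (min (l + 1) n) (fun i => Real.exp (-levT μ lam l i))
            (fun i => Real.exp (-levT μ lam (l + 1) i)) ^ (θ - 1) /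
          (vand (min l n) (fun i => Real.exp (-levT μ lam l i)) ^ (θ - 1) *
            vand (min (l + 1) n) (fun i => Real.exp (-levT μ lam (l + 1) i)) ^ (θ - 1)) *
        Real.exp ((θ - 1) * asum (min l n) (levT μ lam l))

/-- The Heckman–Opdam hypergeometric function `F^{n,m}_β(λ, s)`, `θ = β/2`. -/
def hoF (θ : ℝ) (n m : ℕ) (lam s : ℕ → ℝ) : ℝ :=
  gammaProd θ n m / Real.Gamma θ ^ n *
    (phiHO θ n m lam s /
      (vandTrig n lam ^ θ * ∏ i ∈ range n, (1 - Real.exp (-lam i)) ^ (θ * ((m - n : ℕ) : ℝ))))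

/-- The conjugate Heckman–Opdam hypergeometric function `F̃^{n,m}_β(λ, s)`. -/
def hoFC (θ : ℝ) (n m : ℕ) (lam s : ℕ → ℝ) : ℝ :=
  (Real.Gamma θ)⁻¹ ^ n * (∏ i ∈ range n, (1 - Real.exp (-lam i)) ^ (θ - 1)) * hoF θ n m lam s

/-! ### Ensembles -/

/-- Support of an `m`-level ensemble: interlacing chain with non-negative entries. -/
def chainSupp {m n : ℕ} (μ : Arr m n) : Prop :=
  (∀ l, 1 ≤ l → l < m → interlaces (min l n) (min (l + 1) n) (lev μ l) (lev μ (l + 1))) ∧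
  ∀ l i, 1 ≤ l → l ≤ m → i < min l n → 0 ≤ lev μ l i

/-- Unnormalized density of the multivariate Bessel ensemble. -/
def mvbDensity (θ : ℝ) (n m : ℕ) (piv pih : ℕ → ℝ) : Arr m n → ℝ :=
  Set.indicator {μ | chainSupp μ} fun μ =>
    vand (min m n) (lev μ m) ^ θ *
    Real.exp (-θ * ∑ l ∈ Icc 1 m,
      pih (l - 1) * (asum (min l n) (lev μ l) - asum (min (l - 1) n) (lev μ (l - 1)))) *
    (∏ i ∈ range (min m n), lev μ m i ^ (θ * ((n - min n m : ℕ) : ℝ))) *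
    (∏ i ∈ range (min n m), lev μ (min n m) i ^ (θ - 1) / lev μ m i ^ (θ - 1)) *
    (∏ l ∈ Ico 1 m,
      cross (min l n) (min (l + 1) n) (lev μ l) (lev μ (l + 1)) ^ (θ - 1) /
        (vand (min l n) (lev μ l) ^ (θ - 1) * vand (min (l + 1) n) (lev μ (l + 1)) ^ (θ - 1))) *
    mvBesselC θ (min n m) n (lev μ m) fun i => -θ * piv i

/-- Unnormalized density of the Heckman–Opdam ensemble. -/
def hoDensity (θ : ℝ) (n m : ℕ) (piv pih : ℕ → ℝ) : Arr m n → ℝ :=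
  Set.indicator {μ | chainSupp μ} fun μ =>
    vandTrig (min m n) (lev μ m) ^ θ *
    (∏ i ∈ range (min m n), (1 - Real.exp (-lev μ m i)) ^ (θ * ((n - min m n : ℕ) : ℝ))) *
    (∏ i ∈ range (min m n),
      (1 - Real.exp (-lev μ (min m n) i)) ^ (θ - 1) / (1 - Real.exp (-lev μ m i)) ^ (θ - 1)) *
    Real.exp (-θ * ∑ l ∈ Icc 1 m,
      pih (l - 1) * (asum (min l n) (lev μ l) - asum (min (l - 1) n) (lev μ (l - 1)))) *
    (∏ l ∈ Ico 1 m,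
      cross (min l n) (min (l + 1) n) (fun i => Real.exp (-lev μ l i))
          (fun i => Real.exp (-lev μ (l + 1) i)) ^ (θ - 1) /
        (vand (min l n) (fun i => Real.exp (-lev μ l i)) ^ (θ - 1) *
          vand (min (l + 1) n) (fun i => Real.exp (-lev μ (l + 1) i)) ^ (θ - 1)) *
      Real.exp ((θ - 1) * asum (min l n) (lev μ l))) *
    hoFC θ (min m n) n (lev μ m) fun i => -θ * piv i

/-! ### Random matrices -/

instance matMeasurableSpace (m n : ℕ) (α : Type*) [MeasurableSpace α] :
    MeasurableSpace (Matrix (Fin m) (Fin n) α) :=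
  inferInstanceAs (MeasurableSpace (Fin m → Fin n → α))

/-- Eigenvalues (real parts of the roots of the characteristic polynomial, with
multiplicity) of a complex matrix, sorted in decreasing order; `0` beyond index `n`. -/
def eigsDesc {n : ℕ} (M : Matrix (Fin n) (Fin n) ℂ) : ℕ → ℝ := fun i =>
  (((M.charpoly.roots.map Complex.re).toList.insertionSort (· ≥ ·)).getD i 0)

/-- `(B^T B)` for the first `k` rows of `B`. -/
def gramR {n : ℕ} (k : ℕ) (B : ℕ → Fin n → ℝ) : Matrix (Fin n) (Fin n) ℝ :=
  Matrix.of fun a b => ∑ i ∈ range k, B i a * B i b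

/-- `(B^* B)` for the first `k` rows of `B`. -/
def gramC {n : ℕ} (k : ℕ) (B : ℕ → Fin n → ℂ) : Matrix (Fin n) (Fin n) ℂ :=
  Matrix.of fun a b => ∑ i ∈ range k, (starRingEnd ℂ) (B i a) * B i b

/-- decreasing eigenvalues of the level-`k` real Wishart matrix built from rows of `B` -/
def wishEigR {n : ℕ} (k : ℕ) (B : ℕ → Fin n → ℝ) : ℕ → ℝ :=
  eigsDesc ((gramR k B).map Complex.ofReal)

/-- decreasing eigenvalues of the level-`k` complex Wishart matrix built from rows of `B` -/
def wishEigC {n : ℕ} (k : ℕ) (B : ℕ → Fin n → ℂ) : ℕ → ℝ :=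
  eigsDesc (gramC k B)

/-- the multilevel array of nonzero Wishart eigenvalues (real entries) -/
def wishArrR (n m : ℕ) {Ω : Type*} (A : ℕ → Fin n → Ω → ℝ) (ω : Ω) : Arr m n :=
  fun p => wishEigR (p.1.1 + 1) (fun i j => A i j ω) p.1.2

/-- the multilevel array of nonzero Wishart eigenvalues (complex entries) -/
def wishArrC (n m : ℕ) {Ω : Type*} (A : ℕ → Fin n → Ω → ℂ) (ω : Ω) : Arr m n :=
  fun p => wishEigC (p.1.1 + 1) (fun i j => A i j ω) p.1.2

/-- The complex Gaussian distribution with mean `0` and variance `v = E|z|²`. -/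
def complexGaussian (v : ℝ) : Measure ℂ :=
  Measure.map (fun p : ℝ × ℝ => (⟨p.1, p.2⟩ : ℂ))
    ((gaussianReal 0 (v / 2).toNNReal).prod (gaussianReal 0 (v / 2).toNNReal))

/-- Law of the first `m` levels of eigenvalue arrays of the real generalized Wishart
ensemble with parameters `(p, 0)`. -/
def wishartLawR (n m : ℕ) (p : Fin n → ℝ) : Measure (Arr m n) :=
  Measure.map
    (fun Z : Fin m × Fin n → ℝ => fun c : { q // q ∈ coords m n } =>
      wishEigR (c.1.1 + 1) (fun i j => if h : i < m then Z (⟨i, h⟩, j) else 0) c.1.2)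
    (Measure.pi fun q : Fin m × Fin n => gaussianReal 0 ((p q.2)⁻¹).toNNReal)

/-- Law of the first `m` levels of eigenvalue arrays of the complex generalized Wishart
ensemble with parameters `(p, 0)`. -/
def wishartLawC (n m : ℕ) (p : Fin n → ℝ) : Measure (Arr m n) :=
  Measure.map
    (fun Z : Fin m × Fin n → ℂ => fun c : { q // q ∈ coords m n } =>
      wishEigC (c.1.1 + 1) (fun i j => if h : i < m then Z (⟨i, h⟩, j) else 0) c.1.2)
    (Measure.pi fun q : Fin m × Fin n => complexGaussian (p q.2)⁻¹)

/-! ### Haar-type measures and HCIZ integrals -/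

/-- `ν` is the Haar probability measure on the orthogonal group `O(n)` (identified with the
unique left-invariant probability measure carried by `O(n) ⊆ Matrix (Fin n) (Fin n) ℝ`). -/
def IsHaarOrth (n : ℕ) (ν : Measure (Matrix (Fin n) (Fin n) ℝ)) : Prop :=
  IsProbabilityMeasure ν ∧
    ν ((↑(Matrix.orthogonalGroup (Fin n) ℝ) : Set (Matrix (Fin n) (Fin n) ℝ))ᶜ) = 0 ∧
    ∀ U ∈ Matrix.orthogonalGroup (Fin n) ℝ, Measure.map (fun V => U * V) ν = ν

/-- `ν` is the Haar probability measure on the unitary group `U(n)`. -/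
def IsHaarUnitary (n : ℕ) (ν : Measure (Matrix (Fin n) (Fin n) ℂ)) : Prop :=
  IsProbabilityMeasure ν ∧
    ν ((↑(Matrix.unitaryGroup (Fin n) ℂ) : Set (Matrix (Fin n) (Fin n) ℂ))ᶜ) = 0 ∧
    ∀ U ∈ Matrix.unitaryGroup (Fin n) ℂ, Measure.map (fun V => U * V) ν = ν

/-- first `k` entries of `x`, padded with zeros, as a `Fin n`-vector -/
def pad (n : ℕ) (x : ℕ → ℝ) (k : ℕ) : Fin n → ℝ := fun j => if (j : ℕ) < k then x j else 0

/-- The real HCIZ integral `h¹_a(b) = ∫_{O(n)} e^{-Tr(V a Vᵀ b)/2} dν` with `a` of length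
`ka` and `b` of length `kb`, both padded by zeros. -/
def hcizR (n : ℕ) (ν : Measure (Matrix (Fin n) (Fin n) ℝ)) (a : ℕ → ℝ) (ka : ℕ)
    (b : ℕ → ℝ) (kb : ℕ) : ℝ :=
  ∫ V, Real.exp (-(Matrix.trace (V * Matrix.diagonal (pad n a ka) * V.transpose *
    Matrix.diagonal (pad n b kb))) / 2) ∂ν

/-! ### Jacobi matrices -/

/-- `J_l = (X^{An})^* X^{An} ((X^{An})^* X^{An} + (Y^{ln})^* Y^{ln})⁻¹`, real entries. -/
def jacMatR (A n l : ℕ) (X Y : ℕ → ℕ → ℝ) : Matrix (Fin n) (Fin n) ℝ :=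
  (Matrix.of fun a b : Fin n => ∑ i ∈ range A, X i a * X i b) *
    ((Matrix.of fun a b : Fin n => ∑ i ∈ range A, X i a * X i b) +
      Matrix.of fun a b : Fin n => ∑ i ∈ range l, Y i a * Y i b)⁻¹

/-- `J_l`, complex entries. -/
def jacMatC (A n l : ℕ) (X Y : ℕ → ℕ → ℂ) : Matrix (Fin n) (Fin n) ℂ :=
  (Matrix.of fun a b : Fin n => ∑ i ∈ range A, (starRingEnd ℂ) (X i a) * X i b) *
    ((Matrix.of fun a b : Fin n => ∑ i ∈ range A, (starRingEnd ℂ) (X i a) * X i b) +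
      Matrix.of fun a b : Fin n => ∑ i ∈ range l, (starRingEnd ℂ) (Y i a) * Y i b)⁻¹

/-- `λ^l_i` (0-based `i < l`): the `i`-th largest among the `l` smallest eigenvalues of
`J_l` (real case). -/
def jacEigR (A n l : ℕ) (X Y : ℕ → ℕ → ℝ) (i : ℕ) : ℝ :=
  eigsDesc ((jacMatR A n l X Y).map Complex.ofReal) (n - l + i)

/-- `λ^l_i` (complex case). -/
def jacEigC (A n l : ℕ) (X Y : ℕ → ℕ → ℂ) (i : ℕ) : ℝ :=
  eigsDesc (jacMatC A n l X Y) (n - l + i)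

/-! ### q-analysis -/

/-- finite q-Pochhammer `(x; q)_N` -/
def qpoch (x q : ℝ) (N : ℕ) : ℝ := ∏ k ∈ range N, (1 - x * q ^ k)

/-- infinite q-Pochhammer `(x; q)_∞` -/
def qpochInf (x q : ℝ) : ℝ := ∏' k : ℕ, (1 - x * q ^ k)

/-- `f(u) = (tu; q)_∞/(qu; q)_∞` -/
def macf (q t u : ℝ) : ℝ := qpochInf (t * u) q / qpochInf (q * u) q

/-- Macdonald norm constant `b_ν(q, t)` (1-based parts `ν 1 ≥ ν 2 ≥ ⋯ ≥ ν n`, `ν (n+1) = 0`). -/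
def bMac (n : ℕ) (ν : ℕ → ℕ) (q t : ℝ) : ℝ :=
  ∏ l ∈ Icc 1 n, ∏ i ∈ range l,
    qpoch (t ^ (i + 1) * q ^ (ν (l - i) - ν l)) q (ν l - ν (l + 1)) /
      qpoch (t ^ i * q ^ (ν (l - i) - ν l + 1)) q (ν l - ν (l + 1))

/-- Macdonald branching coefficient `ψ^m_{λ/μ}(q, t)` (0-based index sequences). -/
def psiMac (m : ℕ) (lam mu : ℕ → ℝ) (q t : ℝ) : ℝ :=
  ∏ i ∈ range (m - 1), ∏ j ∈ range (m - 1),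
    if i ≤ j then
      macf q t (q ^ (mu i - mu j) * t ^ (j - i)) *
          macf q t (q ^ (lam i - lam (j + 1)) * t ^ (j - i)) /
        (macf q t (q ^ (mu i - lam (j + 1)) * t ^ (j - i)) *
          macf q t (q ^ (lam i - mu j) * t ^ (j - i)))
    else 1

/-- Truncated Macdonald branching coefficient (0-based index sequences of length `n`). -/
def psiMacT (n : ℕ) (lam mu : ℕ → ℝ) (q t : ℝ) : ℝ :=
  (∏ i ∈ range n, ∏ j ∈ range n,
    if i < j then
      macf q t (q ^ (mu i - mu j) * t ^ (j - i)) *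
          macf q t (q ^ (lam i - lam j) * t ^ (j - i - 1)) /
        (macf q t (q ^ (lam i - mu j) * t ^ (j - i)) *
          macf q t (q ^ (mu i - lam j) * t ^ (j - i - 1)))
    else 1) *
  (∏ i ∈ range n, macf q t 1 / macf q t (q ^ (lam i - mu i))) *
  ∏ i ∈ range n, macf q t (q ^ lam i * t ^ (n - 1 - i)) / macf q t (q ^ mu i * t ^ (n - 1 - i))

/-- Transition kernel density of the β = 1 generalized Wishart eigenvalue chain
(`prev` = level `m-1`, argument = level `m`). -/
def wishKer1 (n : ℕ) (piv pih : ℕ → ℝ) (ν : Measure (Matrix (Fin n) (Fin n) ℝ)) (m : ℕ)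
    (prev : ℕ → ℝ) : (ℕ → ℝ) → ℝ :=
  Set.indicator {y | interlaces (min (m - 1) n) (min m n) prev y} fun y =>
    (∏ i ∈ range n, (piv i + pih (m - 1)) ^ ((1 : ℝ) / 2)) /
        (Real.Gamma (m / 2) * Real.Gamma (1 / 2) ^ m) *
      Real.exp (-(1 / 2) * pih (m - 1) * (asum (min m n) y - asum (min (m - 1) n) prev)) *
      ((∏ i ∈ range (min m n),
          y i ^ (((n : ℝ) - min m n - if m ≤ n then 1 else 0) / 2)) /
        ∏ i ∈ range (min (m - 1) n),
          prev i ^ (((n : ℝ) - min (m - 1) n - if m ≤ n then 1 else 0) / 2)) *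
      (hcizR n ν piv n y (min m n) / hcizR n ν piv n prev (min (m - 1) n)) *
      (vand (min m n) y * cross (min m n) (min (m - 1) n) y prev ^ (-(1 : ℝ) / 2))

/-- Support of the multilevel Jacobi ensemble: interlacing with entries in `[0,1]`. -/
def jacSupp {m n : ℕ} (μ : Arr m n) : Prop :=
  (∀ l, 1 ≤ l → l < m → interlaces (min l n) (min (l + 1) n) (lev μ l) (lev μ (l + 1))) ∧
  ∀ l i, 1 ≤ l → l ≤ m → i < min l n → lev μ l i ∈ Set.Icc (0 : ℝ) 1

/-- Unnormalized density of the first `m` levels of the β = 2 Jacobi ensemble. -/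
def jacDens2 (A n m : ℕ) : Arr m n → ℝ :=
  Set.indicator {μ | jacSupp μ} fun μ =>
    vand (min m n) (lev μ m) *
    (∏ i ∈ range (min m n),
      lev μ m i ^ ((A : ℝ) + m - n - 1) * (1 - lev μ m i) ^ ((n : ℝ) - m)) *
    ∏ l ∈ Ico 1 m, ∏ i ∈ range (min l n), lev μ l i ^ (-2 : ℝ)

/-- Unnormalized density of the first `m` levels of the β = 1 Jacobi ensemble. -/
def jacDens1 (A n m : ℕ) : Arr m n → ℝ :=
  Set.indicator {μ | jacSupp μ} fun μ =>
    vand (min m n) (lev μ m) *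
    (∏ i ∈ range (min m n),
      lev μ m i ^ (((A : ℝ) + m - n - 4) / 2) * (1 - lev μ m i) ^ (((n : ℝ) - m + 1) / 2)) *
    ∏ l ∈ Ico 1 m,
      (∏ i ∈ range (min l n), lev μ l i ^ (-1 : ℝ)) * vand (min l n) (lev μ l) *
        cross (min l n) (min (l + 1) n) (lev μ l) (lev μ (l + 1)) ^ (-(1 : ℝ) / 2)

/-- `(X^{An})^T X^{An}` (real). -/
def SxR (A n : ℕ) (X : ℕ → ℕ → ℝ) : Matrix (Fin n) (Fin n) ℝ :=
  Matrix.of fun a b : Fin n => ∑ i ∈ range A, X i a * X i b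

/-- `(X^{An})^* X^{An}` (complex). -/
def SxC (A n : ℕ) (X : ℕ → ℕ → ℂ) : Matrix (Fin n) (Fin n) ℂ :=
  Matrix.of fun a b : Fin n => ∑ i ∈ range A, (starRingEnd ℂ) (X i a) * X i b

/-- The array `{λ^l_i}_{1 ≤ i ≤ l ≤ m}` of Jacobi eigenvalues (real case). -/
def jacArrR (A n m : ℕ) (X Y : ℕ → ℕ → ℝ) : Arr m n :=
  fun c => jacEigR A n (c.1.1 + 1) X Y c.1.2

/-- The array `{λ^l_i}_{1 ≤ i ≤ l ≤ m}` of Jacobi eigenvalues (complex case). -/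
def jacArrC (A n m : ℕ) (X Y : ℕ → ℕ → ℂ) : Arr m n :=
  fun c => jacEigC A n (c.1.1 + 1) X Y c.1.2

/-- The array `{τ^l_i = (λ^l_{l+1-i})⁻¹ - 1}` (real case). -/
def tauArrR (A n m : ℕ) (X Y : ℕ → ℕ → ℝ) : Arr m n :=
  fun c => (eigsDesc ((jacMatR A n (c.1.1 + 1) X Y).map Complex.ofReal) (n - 1 - c.1.2))⁻¹ - 1

/-- The array `{τ^l_i = (λ^l_{l+1-i})⁻¹ - 1}` (complex case). -/
def tauArrC (A n m : ℕ) (X Y : ℕ → ℕ → ℂ) : Arr m n :=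
  fun c => (eigsDesc (jacMatC A n (c.1.1 + 1) X Y) (n - 1 - c.1.2))⁻¹ - 1

/-! ### Haar measure -/

instance matBorelSpace (k l : ℕ) : BorelSpace (Matrix (Fin k) (Fin l) ℝ) :=
  inferInstanceAs (BorelSpace (Fin k → Fin l → ℝ))

lemma measurable_entry {k l : ℕ} (i : Fin k) (j : Fin l) :
    Measurable (fun V : Matrix (Fin k) (Fin l) ℝ => V i j) :=
  (measurable_pi_apply j).comp (measurable_pi_apply (X := fun _ : Fin k => Fin l → ℝ) i)

lemma measurable_mat {α : Type*} [MeasurableSpace α] {k l : ℕ}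
    (f : α → Matrix (Fin k) (Fin l) ℝ) (h : ∀ i j, Measurable fun x => f x i j) :
    Measurable f :=
  measurable_pi_lambda (X := fun _ : Fin k => Fin l → ℝ) f
    fun i => measurable_pi_lambda _ fun j => h i j

lemma measurable_mat_mul (k : ℕ) :
    Measurable (fun p : Matrix (Fin k) (Fin k) ℝ × Matrix (Fin k) (Fin k) ℝ => p.1 * p.2) := by
  refine measurable_mat _ fun i j => ?_
  simp only [Matrix.mul_apply]
  refine Finset.measurable_sum _ fun c _ => ?_
  exact ((measurable_entry i c).comp measurable_fst).mul ((measurable_entry c j).comp measurable_snd)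

lemma measurable_mul_left' {k : ℕ} (U : Matrix (Fin k) (Fin k) ℝ) :
    Measurable (fun V : Matrix (Fin k) (Fin k) ℝ => U * V) :=
  (measurable_mat_mul k).comp (measurable_const.prodMk measurable_id)

lemma measurable_mul_right' {k : ℕ} (U : Matrix (Fin k) (Fin k) ℝ) :
    Measurable (fun V : Matrix (Fin k) (Fin k) ℝ => V * U) :=
  (measurable_mat_mul k).comp (measurable_id.prodMk measurable_const)

lemma measurable_transpose' (k : ℕ) :
    Measurable (fun V : Matrix (Fin k) (Fin k) ℝ => V.transpose) :=
  measurable_mat _ fun i j => measurable_entry j i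

lemma orth_transpose {k : ℕ} {U : Matrix (Fin k) (Fin k) ℝ}
    (h : U ∈ Matrix.orthogonalGroup (Fin k) ℝ) :
    U.transpose ∈ Matrix.orthogonalGroup (Fin k) ℝ := by
  rw [Matrix.mem_orthogonalGroup_iff] 
  rw [Matrix.mem_orthogonalGroup_iff'] at h
  simpa using h

lemma haar_ae {k : ℕ} {ν : Measure (Matrix (Fin k) (Fin k) ℝ)} (h : IsHaarOrth k ν) :
    ∀ᵐ V ∂ν, V ∈ Matrix.orthogonalGroup (Fin k) ℝ := h.2.1

lemma haar_left {k : ℕ} {ν : Measure (Matrix (Fin k) (Fin k) ℝ)} (h : IsHaarOrth k ν)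
    {U : Matrix (Fin k) (Fin k) ℝ} (hU : U ∈ Matrix.orthogonalGroup (Fin k) ℝ)
    {f : Matrix (Fin k) (Fin k) ℝ → ℝ≥0∞} (hf : Measurable f) :
    ∫⁻ V, f (U * V) ∂ν = ∫⁻ V, f V ∂ν := by
  conv_rhs => rw [← h.2.2 U hU]
  rw [lintegral_map hf (measurable_mul_left' U)]

lemma haar_transpose {k : ℕ} {ν : Measure (Matrix (Fin k) (Fin k) ℝ)} (h : IsHaarOrth k ν)
    {f : Matrix (Fin k) (Fin k) ℝ → ℝ≥0∞} (hf : Measurable f) :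
    ∫⁻ V, f V.transpose ∂ν = ∫⁻ V, f V ∂ν := by
  have := h.1
  have h1 : ∫⁻ W, ∫⁻ V, f (W.transpose * V) ∂ν ∂ν = ∫⁻ V, f V ∂ν := by
    have : ∀ᵐ W ∂ν, ∫⁻ V, f (W.transpose * V) ∂ν = ∫⁻ V, f V ∂ν := by
      filter_upwards [haar_ae h] with W hW
      exact haar_left h (orth_transpose hW) hf
    rw [lintegral_congr_ae this]
    simp
  have hm : Measurable (fun p : Matrix (Fin k) (Fin k) ℝ × Matrix (Fin k) (Fin k) ℝ =>
      f (p.1.transpose * p.2)) :=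
    hf.comp ((measurable_mat_mul k).comp
      (((measurable_transpose' k).comp measurable_fst).prodMk measurable_snd))
  rw [lintegral_lintegral_swap hm.aemeasurable] at h1
  rw [← h1]
  have : ∀ᵐ V ∂ν, ∫⁻ W, f (W.transpose * V) ∂ν = ∫⁻ W, f W.transpose ∂ν := by
    filter_upwards [haar_ae h] with V hV
    have := haar_left h (orth_transpose hV) (f := fun W => f W.transpose)
      (hf.comp (measurable_transpose' k))
    simpa [Matrix.transpose_mul] using this
  rw [lintegral_congr_ae this]
  simp

lemma haar_right {k : ℕ} {ν : Measure (Matrix (Fin k) (Fin k) ℝ)} (h : IsHaarOrth k ν)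
    {U : Matrix (Fin k) (Fin k) ℝ} (hU : U ∈ Matrix.orthogonalGroup (Fin k) ℝ)
    {f : Matrix (Fin k) (Fin k) ℝ → ℝ≥0∞} (hf : Measurable f) :
    ∫⁻ V, f (V * U) ∂ν = ∫⁻ V, f V ∂ν := by
  have h1 := haar_transpose h (f := fun V => f (V * U)) (hf.comp (measurable_mul_right' U))
  have h2 := haar_left h (orth_transpose hU) (f := fun W => f W.transpose)
      (hf.comp (measurable_transpose' k))
  simp only [Matrix.transpose_mul, Matrix.transpose_transpose] at h2
  rw [← h1, h2, haar_transpose h hf]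

lemma mem_orth_iff_unitary {k : ℕ} {A : Matrix (Fin k) (Fin k) ℝ} :
    A ∈ Matrix.orthogonalGroup (Fin k) ℝ ↔ A ∈ Matrix.unitaryGroup (Fin k) ℝ := by
  rw [Matrix.mem_orthogonalGroup_iff]

lemma isCompact_unitary (k : ℕ) :
    IsCompact (Matrix.unitaryGroup (Fin k) ℝ : Set (Matrix (Fin k) (Fin k) ℝ)) := by
  have hK : IsCompact (Set.pi Set.univ fun _ : Fin k => Set.pi Set.univ fun _ : Fin k =>
      Set.Icc (-1 : ℝ) 1) :=
    isCompact_univ_pi fun _ => isCompact_univ_pi fun _ => isCompact_Icc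
  have hc : IsClosed (Matrix.unitaryGroup (Fin k) ℝ : Set (Matrix (Fin k) (Fin k) ℝ)) := by
    have : (Matrix.unitaryGroup (Fin k) ℝ : Set (Matrix (Fin k) (Fin k) ℝ)) =
        {A | A * star A = 1} := by
      ext A; exact Matrix.mem_unitaryGroup_iff
    rw [this]
    exact isClosed_eq (by fun_prop) continuous_const
  refine IsCompact.of_isClosed_subset hK hc ?_
  intro A hA i _ j _
  have := entry_norm_bound_of_unitary hA i j
  rw [Real.norm_eq_abs, abs_le] at this
  exact this

lemma haar_exists (k : ℕ) : ∃ ν : Measure (Matrix (Fin k) (Fin k) ℝ), IsHaarOrth k ν := by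
  let G := Matrix.unitaryGroup (Fin k) ℝ
  let : MeasurableSpace G := borel G
  have : BorelSpace G := ⟨rfl⟩
  have : CompactSpace G := isCompact_iff_compactSpace.mp (isCompact_unitary k)
  let μ : Measure G := Measure.haarMeasure ⊤
  have hval : Measurable (Subtype.val : G → Matrix (Fin k) (Fin k) ℝ) :=
    continuous_subtype_val.measurable
  have hμ : μ Set.univ = 1 := by
    have := Measure.haarMeasure_self (K₀ := (⊤ : TopologicalSpace.PositiveCompacts G))
    simpa using this
  refine ⟨Measure.map Subtype.val μ, ⟨?_⟩, ?_, ?_⟩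
  · rw [Measure.map_apply hval MeasurableSet.univ]; simpa using hμ
  · have hm : MeasurableSet ((↑(Matrix.orthogonalGroup (Fin k) ℝ) :
        Set (Matrix (Fin k) (Fin k) ℝ))ᶜ) := by
      have : (↑(Matrix.orthogonalGroup (Fin k) ℝ) : Set (Matrix (Fin k) (Fin k) ℝ)) =
        (Matrix.unitaryGroup (Fin k) ℝ : Set (Matrix (Fin k) (Fin k) ℝ)) := by
        ext A; exact mem_orth_iff_unitary
      rw [this]
      exact (isCompact_unitary k).isClosed.measurableSet.compl
    rw [Measure.map_apply hval hm]
    have : (Subtype.val ⁻¹' ((↑(Matrix.orthogonalGroup (Fin k) ℝ) :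
        Set (Matrix (Fin k) (Fin k) ℝ))ᶜ) : Set G) = ∅ := by
      ext x
      simp
    rw [this]; simp
  · intro U hU
    let u : G := ⟨U, mem_orth_iff_unitary.mp hU⟩
    rw [Measure.map_map (measurable_mul_left' U) hval]
    have h1 : Measure.map (fun x : G => u * x) μ = μ := map_mul_left_eq_self μ u
    conv_rhs => rw [← h1]
    rw [Measure.map_map hval (measurable_const_mul u)]
    rfl

lemma orth_mul {k : ℕ} {U : Matrix (Fin k) (Fin k) ℝ}
    (h : U ∈ Matrix.orthogonalGroup (Fin k) ℝ) : U * U.transpose = 1 := by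
  rwa [Matrix.mem_orthogonalGroup_iff] at h

lemma orth_mul' {k : ℕ} {U : Matrix (Fin k) (Fin k) ℝ}
    (h : U ∈ Matrix.orthogonalGroup (Fin k) ℝ) : U.transpose * U = 1 := by
  rwa [Matrix.mem_orthogonalGroup_iff'] at h

/-! ### The integrand, block embedding, Householder matrices -/

/-- the exponential integrand -/
def qf {k : ℕ} (s a : Fin k → ℝ) (V : Matrix (Fin k) (Fin k) ℝ) : ℝ≥0∞ :=
  ENNReal.ofReal (Real.exp (∑ l, s l * ∑ i, a i * V l i ^ 2))

lemma measurable_qf {k : ℕ} (s a : Fin k → ℝ) : Measurable (qf s a) := by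
  unfold qf
  refine ENNReal.measurable_ofReal.comp (Real.measurable_exp.comp ?_)
  refine Finset.measurable_sum _ fun l _ => ?_
  refine Measurable.const_mul (Finset.measurable_sum _ fun i _ => ?_) _
  exact Measurable.const_mul ((measurable_entry l i).pow_const 2) _

/-- `W ↦ diag(W, 1)` -/
def emb {m : ℕ} (W : Matrix (Fin m) (Fin m) ℝ) : Matrix (Fin (m + 1)) (Fin (m + 1)) ℝ :=
  Matrix.of fun i j => Fin.lastCases (motive := fun _ => ℝ)
    (Fin.lastCases (motive := fun _ => ℝ) 1 (fun _ => 0) j)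
    (fun i' => Fin.lastCases (motive := fun _ => ℝ) 0 (fun j' => W i' j') j) i

@[simp] lemma emb_ll {m : ℕ} (W : Matrix (Fin m) (Fin m) ℝ) :
    emb W (Fin.last m) (Fin.last m) = 1 := by simp [emb]
@[simp] lemma emb_lc {m : ℕ} (W : Matrix (Fin m) (Fin m) ℝ) (j : Fin m) :
    emb W (Fin.last m) j.castSucc = 0 := by simp [emb]
@[simp] lemma emb_cl {m : ℕ} (W : Matrix (Fin m) (Fin m) ℝ) (i : Fin m) :
    emb W i.castSucc (Fin.last m) = 0 := by simp [emb]
@[simp] lemma emb_cc {m : ℕ} (W : Matrix (Fin m) (Fin m) ℝ) (i j : Fin m) :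
    emb W i.castSucc j.castSucc = W i j := by simp [emb]

lemma emb_mul {m : ℕ} (W W' : Matrix (Fin m) (Fin m) ℝ) : emb (W * W') = emb W * emb W' := by
  ext i j
  induction i using Fin.lastCases <;> induction j using Fin.lastCases <;>
    simp [Matrix.mul_apply, Fin.sum_univ_castSucc]

lemma emb_transpose {m : ℕ} (W : Matrix (Fin m) (Fin m) ℝ) :
    emb W.transpose = (emb W).transpose := by
  ext i j
  induction i using Fin.lastCases <;> induction j using Fin.lastCases <;>
    simp

lemma emb_one {m : ℕ} : emb (1 : Matrix (Fin m) (Fin m) ℝ) = 1 := by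
  ext i j
  induction i using Fin.lastCases with
  | last => 
    induction j using Fin.lastCases with
    | last => simp
    | cast j => simp [Matrix.one_apply, (Fin.castSucc_lt_last j).ne']
  | cast i =>
    induction j using Fin.lastCases with
    | last => simp [Matrix.one_apply, (Fin.castSucc_lt_last i).ne]
    | cast j => simp [Matrix.one_apply]

lemma emb_orth {m : ℕ} {W : Matrix (Fin m) (Fin m) ℝ}
    (h : W ∈ Matrix.orthogonalGroup (Fin m) ℝ) :
    emb W ∈ Matrix.orthogonalGroup (Fin (m + 1)) ℝ := by
  rw [Matrix.mem_orthogonalGroup_iff] at h ⊢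
  rw [← emb_transpose, ← emb_mul, h, emb_one]

lemma measurable_emb (m : ℕ) : Measurable (emb (m := m)) := by
  refine measurable_mat _ fun i j => ?_
  induction i using Fin.lastCases with
  | last => 
    induction j using Fin.lastCases with
    | last => simp
    | cast j => simp
  | cast i =>
    induction j using Fin.lastCases with
    | last => simp
    | cast j => simpa using measurable_entry i j

lemma exists_emb {m : ℕ} {U : Matrix (Fin (m + 1)) (Fin (m + 1)) ℝ}
    (hU : U ∈ Matrix.orthogonalGroup (Fin (m + 1)) ℝ)
    (hl : ∀ j, U (Fin.last m) j = (1 : Matrix (Fin (m + 1)) (Fin (m + 1)) ℝ) (Fin.last m) j) :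
    ∃ W ∈ Matrix.orthogonalGroup (Fin m) ℝ, U = emb W := by
  rw [Matrix.mem_orthogonalGroup_iff] at hU
  have hc : ∀ i : Fin m, U i.castSucc (Fin.last m) = 0 := by
    intro i
    have := congrFun (congrFun hU i.castSucc) (Fin.last m)
    simp only [Matrix.mul_apply, Matrix.transpose_apply, hl] at this
    simpa [Matrix.one_apply, (Fin.castSucc_lt_last i).ne] using this
  refine ⟨Matrix.of fun i j => U i.castSucc j.castSucc, ?_, ?_⟩
  · rw [Matrix.mem_orthogonalGroup_iff]
    ext i j
    have := congrFun (congrFun hU i.castSucc) j.castSucc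
    simp only [Matrix.mul_apply, Matrix.transpose_apply, Fin.sum_univ_castSucc, hc] at this
    simpa [Matrix.mul_apply, Matrix.one_apply] using this
  · ext i j
    induction i using Fin.lastCases with
    | last => 
      induction j using Fin.lastCases with
      | last => simp [hl]
      | cast j => simp [hl, Matrix.one_apply, (Fin.castSucc_lt_last j).ne']
    | cast i =>
      induction j using Fin.lastCases with
      | last => simp [hc]
      | cast j => simp

/-- Householder vector -/
def hv {m : ℕ} (x : Fin (m + 1) → ℝ) (i : Fin (m + 1)) : ℝ :=
  (if i = Fin.last m then 1 else 0) - x i / √(∑ j, x j ^ 2)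

/-- Householder matrix -/
def hh {m : ℕ} (x : Fin (m + 1) → ℝ) : Matrix (Fin (m + 1)) (Fin (m + 1)) ℝ :=
  Matrix.of fun i j => (if i = j then 1 else 0) - 2 / (∑ k, hv x k ^ 2) * (hv x i * hv x j)

lemma hh_orth {m : ℕ} (x : Fin (m + 1) → ℝ) :
    hh x ∈ Matrix.orthogonalGroup (Fin (m + 1)) ℝ := by
  rw [Matrix.mem_orthogonalGroup_iff]
  ext i j
  simp only [Matrix.mul_apply, Matrix.transpose_apply, hh, Matrix.of_apply]
  set v := hv x
  set c := 2 / (∑ k, v k ^ 2) with hc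
  have h1 : ∀ k, ((if i = k then (1:ℝ) else 0) - c * (v i * v k)) *
      ((if j = k then 1 else 0) - c * (v j * v k)) =
      (if i = k then (if j = k then 1 else 0) - c * (v j * v k) else 0)
       - (if j = k then c * (v i * v k) else 0) + c ^ 2 * v i * v j * v k ^ 2 := by
    intro k; split_ifs <;> ring
  simp only [h1]
  rw [Finset.sum_add_distrib, Finset.sum_sub_distrib, Finset.sum_ite_eq, Finset.sum_ite_eq,
    ← Finset.mul_sum]
  have h2 : c ^ 2 * (∑ k, v k ^ 2) = 2 * c := by
    by_cases h : (∑ k, v k ^ 2) = 0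
    · rw [hc, h]; simp
    · rw [hc]; field_simp
  have h3 : c ^ 2 * v i * v j * (∑ k, v k ^ 2) = 2 * c * (v i * v j) := by
    rw [← h2]; ring
  rw [h3]
  simp only [Finset.mem_univ, if_true, Matrix.one_apply, eq_comm (a := j) (b := i)]
  ring

lemma hh_row {m : ℕ} (x : Fin (m + 1) → ℝ) (hx : 0 < ∑ j, x j ^ 2) (j : Fin (m + 1)) :
    hh x (Fin.last m) j = x j / √(∑ j, x j ^ 2) := by
  simp only [hh, Matrix.of_apply]
  have hN : 0 < √(∑ j, x j ^ 2) := Real.sqrt_pos.mpr hx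
  have hN2 : √(∑ j, x j ^ 2) ^ 2 = ∑ j, x j ^ 2 := Real.sq_sqrt hx.le
  have h1 : ∑ k, hv x k ^ 2 = 2 * hv x (Fin.last m) := by
    have : ∀ k, hv x k ^ 2 = (if k = Fin.last m then 1 - 2 * (x k / √(∑ j, x j ^ 2)) else 0)
        + x k ^ 2 / (√(∑ j, x j ^ 2)) ^ 2 := by
      intro k; unfold hv; split_ifs
      · ring
      · ring
    simp only [this]
    rw [Finset.sum_add_distrib, Finset.sum_ite_eq', ← Finset.sum_div, hN2, div_self hx.ne']
    simp [hv]; ring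
  rw [h1]
  by_cases h : hv x (Fin.last m) = 0
  · rw [h] at h1
    have : hv x j = 0 := by
      have := (Finset.sum_eq_zero_iff_of_nonneg (fun i _ => sq_nonneg (hv x i))).mp
        (h1.trans (by simp)) j (Finset.mem_univ _)
      simpa using this
    rw [this, h]
    unfold hv at this
    simp only [eq_comm (a := Fin.last m) (b := j)]
    linarith
  · have : 2 / (2 * hv x (Fin.last m)) * (hv x (Fin.last m) * hv x j) = hv x j := by
      field_simp
    rw [this]; unfold hv
    simp only [eq_comm (a := Fin.last m) (b := j)]
    ring

lemma measurable_hh (m : ℕ) : Measurable (hh (m := m)) := by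
  have hv' : ∀ i, Measurable fun x : Fin (m + 1) → ℝ => hv x i := by
    intro i; unfold hv; fun_prop
  refine measurable_mat _ fun i j => ?_
  simp only [hh, Matrix.of_apply]
  fun_prop

/-- average over the block `O(m)`, as function of the last row -/
def Phi {m : ℕ} (s a : Fin (m + 1) → ℝ) (κ : Measure (Matrix (Fin m) (Fin m) ℝ))
    (x : Fin (m + 1) → ℝ) : ℝ≥0∞ :=
  ∫⁻ W, qf s a (emb W * hh x) ∂κ

lemma measurable_Phi {m : ℕ} (s a : Fin (m + 1) → ℝ) (κ : Measure (Matrix (Fin m) (Fin m) ℝ))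
    [SFinite κ] : Measurable (Phi s a κ) := by
  unfold Phi
  refine Measurable.lintegral_prod_right
    (f := fun x W => qf s a (emb W * hh x)) ?_
  exact (measurable_qf s a).comp ((measurable_mat_mul _).comp
    (((measurable_emb m).comp measurable_snd).prodMk ((measurable_hh m).comp measurable_fst)))

lemma Phi_eq {m : ℕ} (s a : Fin (m + 1) → ℝ) {κ : Measure (Matrix (Fin m) (Fin m) ℝ)}
    (hκ : IsHaarOrth m κ) (x : Fin (m + 1) → ℝ) (hx : 0 < ∑ j, x j ^ 2)
    {V : Matrix (Fin (m + 1)) (Fin (m + 1)) ℝ}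
    (hV : V ∈ Matrix.orthogonalGroup (Fin (m + 1)) ℝ)
    (h : ∀ i, V (Fin.last m) i ^ 2 * (∑ j, x j ^ 2) = x i ^ 2) :
    Phi s a κ x = ∫⁻ W, qf s a (emb W * V) ∂κ := by
  set N := √(∑ j, x j ^ 2) with hN
  have hN0 : 0 < N := Real.sqrt_pos.mpr hx
  have hN2 : N ^ 2 = ∑ j, x j ^ 2 := Real.sq_sqrt hx.le
  let ε : Fin (m + 1) → ℝ := fun i => if V (Fin.last m) i * N = x i then 1 else -1
  have hε2 : ∀ i, ε i ^ 2 = 1 := by intro i; simp only [ε]; split_ifs <;> norm_num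
  have hε : ∀ i, V (Fin.last m) i * ε i = x i / N := by
    intro i
    have h1 : (V (Fin.last m) i * N) ^ 2 = x i ^ 2 := by rw [mul_pow, hN2, h]
    rw [eq_div_iff hN0.ne']
    simp only [ε]
    split_ifs with h2
    · rw [mul_one, h2]
    · rcases sq_eq_sq_iff_eq_or_eq_neg.mp h1 with h3 | h3
      · exact absurd h3 h2
      · linarith
  let V' : Matrix (Fin (m + 1)) (Fin (m + 1)) ℝ := V * Matrix.diagonal ε
  have hD : Matrix.diagonal ε ∈ Matrix.orthogonalGroup (Fin (m + 1)) ℝ := by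
    rw [Matrix.mem_orthogonalGroup_iff, Matrix.diagonal_transpose, Matrix.diagonal_mul_diagonal]
    have : (fun i => ε i * ε i) = fun _ => 1 := by ext i; rw [← sq, hε2]
    rw [this, Matrix.diagonal_one]
  have hV' : V' ∈ Matrix.orthogonalGroup (Fin (m + 1)) ℝ := mul_mem hV hD
  have hU := mul_mem hV' (orth_transpose (hh_orth x))
  obtain ⟨W0, hW0, hW⟩ := exists_emb hU (by
    intro j
    have h1 := orth_mul (hh_orth x)
    rw [← h1, Matrix.mul_apply, Matrix.mul_apply]
    refine Finset.sum_congr rfl fun i _ => ?_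
    have h2 : V' (Fin.last m) i = V (Fin.last m) i * ε i := Matrix.mul_diagonal _ _ _ _
    rw [hh_row x hx, h2, hε])
  have hV'' : V' = emb W0 * hh x := by
    rw [← hW, Matrix.mul_assoc, orth_mul' (hh_orth x), Matrix.mul_one]
  have hq : ∀ W, qf s a (emb W * V) = qf s a (emb W * V') := by
    intro W
    simp only [V', ← Matrix.mul_assoc]
    unfold qf
    simp only [Matrix.mul_diagonal, mul_pow, hε2, mul_one]
  simp only [hq, hV'', ← Matrix.mul_assoc, ← emb_mul]
  unfold Phi
  exact (haar_right hκ hW0 (f := fun W => qf s a (emb W * hh x))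
    ((measurable_qf s a).comp ((measurable_mul_right' _).comp (measurable_emb m)))).symm

lemma haar_block {m : ℕ} (s a : Fin (m + 1) → ℝ) {κ : Measure (Matrix (Fin m) (Fin m) ℝ)}
    (hκ : IsHaarOrth m κ) {ν : Measure (Matrix (Fin (m + 1)) (Fin (m + 1)) ℝ)}
    (hν : IsHaarOrth (m + 1) ν) (R : Matrix (Fin (m + 1)) (Fin (m + 1)) ℝ)
    (hR : R ∈ Matrix.orthogonalGroup (Fin (m + 1)) ℝ) :
    ∫⁻ V, ∫⁻ W, qf s a (emb W * (R * V)) ∂κ ∂ν = ∫⁻ V, qf s a V ∂ν := by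
  have := hκ.1
  have := hν.1
  rw [lintegral_lintegral_swap]
  · have : ∀ᵐ W ∂κ, ∫⁻ V, qf s a (emb W * (R * V)) ∂ν = ∫⁻ V, qf s a V ∂ν := by
      filter_upwards [haar_ae hκ] with W hW
      simp only [← Matrix.mul_assoc]
      exact haar_left hν (mul_mem (emb_orth hW) hR) (measurable_qf s a)
    rw [lintegral_congr_ae this]
    simp
  · refine Measurable.aemeasurable ?_
    exact (measurable_qf s a).comp ((measurable_mat_mul _).comp
      (((measurable_emb m).comp measurable_snd).prodMk
        ((measurable_mul_left' R).comp measurable_fst)))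

lemma sum_sq_orth {k : ℕ} {V : Matrix (Fin k) (Fin k) ℝ}
    (hV : V ∈ Matrix.orthogonalGroup (Fin k) ℝ) (x : Fin k → ℝ) :
    ∑ i, (V.mulVec x i) ^ 2 = ∑ i, x i ^ 2 := by
  have h1 : ∀ y : Fin k → ℝ, ∑ i, y i ^ 2 = y ⬝ᵥ y := by
    intro y; simp [dotProduct, sq]
  rw [h1, h1, Matrix.dotProduct_mulVec, Matrix.vecMul_mulVec,
    orth_mul' hV, Matrix.vecMul_one]

lemma det_orth {k : ℕ} {V : Matrix (Fin k) (Fin k) ℝ}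
    (hV : V ∈ Matrix.orthogonalGroup (Fin k) ℝ) : |V.det| = 1 := by
  have := congrArg Matrix.det (orth_mul hV)
  rw [Matrix.det_mul, Matrix.det_transpose, Matrix.det_one, ← sq] at this
  rcases sq_eq_sq_iff_eq_or_eq_neg.mp (this.trans (one_pow 2).symm) with h | h <;> simp [h]

lemma gauss_lemma {m : ℕ} (s a : Fin (m + 1) → ℝ) {κ : Measure (Matrix (Fin m) (Fin m) ℝ)}
    (hκ : IsHaarOrth m κ) {ν : Measure (Matrix (Fin (m + 1)) (Fin (m + 1)) ℝ)}
    (hν : IsHaarOrth (m + 1) ν) :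
    ∫⁻ x : Fin (m + 1) → ℝ, Phi s a κ x * ENNReal.ofReal (Real.exp (-∑ i, x i ^ 2)) =
      (∫⁻ V, qf s a V ∂ν) *
        ∫⁻ x : Fin (m + 1) → ℝ, ENNReal.ofReal (Real.exp (-∑ i, x i ^ 2)) := by
  have := hκ.1
  have := hν.1
  have hPhi := measurable_Phi s a κ
  have he : Measurable fun x : Fin (m + 1) → ℝ => ENNReal.ofReal (Real.exp (-∑ i, x i ^ 2)) := by
    fun_prop
  have h1 : ∀ᵐ V ∂ν, ∫⁻ x : Fin (m + 1) → ℝ, Phi s a κ (V.transpose.mulVec x) *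
      ENNReal.ofReal (Real.exp (-∑ i, x i ^ 2)) =
      ∫⁻ x : Fin (m + 1) → ℝ, Phi s a κ x * ENNReal.ofReal (Real.exp (-∑ i, x i ^ 2)) := by
    filter_upwards [haar_ae hν] with V hV
    have hd := det_orth (orth_transpose hV)
    have hmap : Measure.map (Matrix.toLin' V.transpose) volume = volume := by
      rw [Real.map_matrix_volume_pi_eq_smul_volume_pi (by intro h; rw [h] at hd; simp at hd),
        abs_inv, hd]
      simp
    conv_rhs => rw [← hmap]
    rw [lintegral_map (f := fun x => Phi s a κ x * ENNReal.ofReal (Real.exp (-∑ i, x i ^ 2)))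
      (hPhi.mul he) (LinearMap.continuous_on_pi _).measurable]
    refine lintegral_congr fun x => ?_
    rw [Matrix.toLin'_apply, sum_sq_orth (orth_transpose hV)]
  have h2 : ∫⁻ V, (∫⁻ x : Fin (m + 1) → ℝ, Phi s a κ (V.transpose.mulVec x) *
      ENNReal.ofReal (Real.exp (-∑ i, x i ^ 2))) ∂ν =
      ∫⁻ x : Fin (m + 1) → ℝ, Phi s a κ x * ENNReal.ofReal (Real.exp (-∑ i, x i ^ 2)) := by
    rw [lintegral_congr_ae h1]; simp
  rw [← h2, lintegral_lintegral_swap]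
  · rw [← lintegral_const_mul _ he]
    have h0 : ∀ᵐ x : Fin (m + 1) → ℝ, x ≠ 0 := by
      simp [ae_iff, measure_singleton]
    refine lintegral_congr_ae ?_
    filter_upwards [h0] with x hx
    have hx2 : 0 < ∑ j, x j ^ 2 := by
      rcases (Finset.sum_nonneg fun i (_ : i ∈ Finset.univ) => sq_nonneg (x i)).eq_or_lt with h | h
      · exfalso; apply hx
        ext j
        simpa using (Finset.sum_eq_zero_iff_of_nonneg fun i _ => sq_nonneg (x i)).mp h.symm j
          (Finset.mem_univ j)
      · exact h
    rw [lintegral_mul_const']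
    · congr 1
      rw [← haar_block s a hκ hν (hh x) (hh_orth x)]
      refine lintegral_congr_ae ?_
      filter_upwards [haar_ae hν] with V hV
      have hs := sum_sq_orth (orth_transpose hV) x
      refine Phi_eq s a hκ _ (by rw [hs]; exact hx2) (mul_mem (hh_orth x) hV) ?_
      intro i
      rw [hs, Matrix.mul_apply]
      simp only [hh_row x hx2, div_mul_eq_mul_div]
      rw [← Finset.sum_div, div_pow, Real.sq_sqrt hx2.le, div_mul_cancel₀ _ hx2.ne']
      congr 1
      simp [Matrix.mulVec, dotProduct, mul_comm]
    · exact ENNReal.ofReal_ne_top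
  · refine Measurable.aemeasurable ?_
    refine Measurable.mul (hPhi.comp ?_) (he.comp measurable_snd)
    refine measurable_pi_lambda _ fun i => ?_
    simp only [Matrix.mulVec, dotProduct, Matrix.transpose_apply]
    refine Finset.measurable_sum _ fun j _ => ?_
    exact ((measurable_entry j i).comp measurable_fst).mul
      ((measurable_pi_apply j).comp measurable_snd)

/-! ### Projective coordinates -/

lemma lint_gauss (k : ℕ) :
    ∫⁻ x : Fin k → ℝ, ENNReal.ofReal (Real.exp (-∑ i, x i ^ 2)) =
      ENNReal.ofReal (Real.Gamma (1 / 2) ^ k) := by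
  have h1 : ∫ x : Fin k → ℝ, Real.exp (-∑ i, x i ^ 2) = Real.Gamma (1 / 2) ^ k := by
    have h2 : ∀ x : Fin k → ℝ, Real.exp (-∑ i, x i ^ 2) = ∏ i, Real.exp (-1 * x i ^ 2) := by
      intro x; rw [← Real.exp_sum, ← Finset.mul_sum]; simp
    simp only [h2]
    rw [integral_fintype_prod_volume_eq_pow (fun x : ℝ => Real.exp (-1 * x ^ 2)),
      integral_gaussian, Real.Gamma_one_half_eq]
    simp
  have hpos : 0 < Real.Gamma (1 / 2) ^ k := pow_pos (Real.Gamma_pos_of_pos (by norm_num)) _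
  have hint : Integrable fun x : Fin k → ℝ => Real.exp (-∑ i, x i ^ 2) := by
    by_contra h
    rw [integral_undef h] at h1
    exact hpos.ne h1
  rw [← h1, ofReal_integral_eq_lintegral_ofReal hint (ae_of_all _ fun x => (Real.exp_pos _).le)]

lemma lint_radial (m : ℕ) {c : ℝ} (hc : 0 < c) :
    ∫⁻ r : ℝ, ENNReal.ofReal (|r| ^ m * Real.exp (-c * r ^ 2)) =
      ENNReal.ofReal (Real.Gamma (((m : ℝ) + 1) / 2) * c ^ (-((m : ℝ) + 1) / 2)) := by
  have h1 : ∫ r : ℝ, |r| ^ m * Real.exp (-c * r ^ 2) =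
      Real.Gamma (((m : ℝ) + 1) / 2) * c ^ (-((m : ℝ) + 1) / 2) := by
    have h2 := integral_comp_abs (f := fun r => r ^ m * Real.exp (-c * r ^ 2))
    simp only [sq_abs] at h2
    rw [h2]
    have h3 := integral_rpow_mul_exp_neg_mul_rpow (p := 2) (q := m) (b := c) (by norm_num)
      (by have : (0:ℝ) ≤ m := Nat.cast_nonneg m
          linarith) hc
    simp only [Real.rpow_natCast, Real.rpow_ofNat] at h3
    rw [h3]; ring
  have hpos : 0 < Real.Gamma (((m : ℝ) + 1) / 2) * c ^ (-((m : ℝ) + 1) / 2) :=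
    mul_pos (Real.Gamma_pos_of_pos (by positivity)) (Real.rpow_pos_of_pos hc _)
  have hint : Integrable fun r : ℝ => |r| ^ m * Real.exp (-c * r ^ 2) := by
    by_contra h
    rw [integral_undef h] at h1
    exact hpos.ne h1
  rw [← h1, ofReal_integral_eq_lintegral_ofReal hint (ae_of_all _ fun x => by positivity)]

lemma proj_coords {m : ℕ} (F : (Fin (m + 1) → ℝ) → ℝ≥0∞) (hF : Measurable F)
    (hh : ∀ (t : Fin m → ℝ) (r : ℝ), r ≠ 0 →
      F (Fin.snoc (α := fun _ => ℝ) (r • t) r) = F (Fin.snoc (α := fun _ => ℝ) t 1)) :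
    ∫⁻ x : Fin (m + 1) → ℝ, F x * ENNReal.ofReal (Real.exp (-∑ i, x i ^ 2)) =
      ENNReal.ofReal (Real.Gamma (((m : ℝ) + 1) / 2)) *
        ∫⁻ t : Fin m → ℝ, F (Fin.snoc (α := fun _ => ℝ) t 1) *
          ENNReal.ofReal ((1 + ∑ i, t i ^ 2) ^ (-((m : ℝ) + 1) / 2)) := by
  have hsn : Measurable fun p : ℝ × (Fin m → ℝ) => (Fin.snoc (α := fun _ => ℝ) p.2 p.1 :
      Fin (m + 1) → ℝ) := by
    refine measurable_pi_lambda _ fun i => ?_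
    induction i using Fin.lastCases with
    | last => simpa using measurable_fst
    | cast i =>
      simp only [Fin.snoc_castSucc]
      exact (measurable_pi_apply i).comp measurable_snd
  have he : Measurable fun x : Fin (m + 1) → ℝ => ENNReal.ofReal (Real.exp (-∑ i, x i ^ 2)) := by
    fun_prop
  have e := (volume_preserving_piFinSuccAbove (fun _ : Fin (m + 1) => ℝ) (Fin.last m)).symm
  rw [← e.lintegral_comp (f := fun x => F x * ENNReal.ofReal (Real.exp (-∑ i, x i ^ 2)))
    (hF.mul he)]
  have hes : ∀ p : ℝ × (Fin m → ℝ), (MeasurableEquiv.piFinSuccAbove (fun _ : Fin (m + 1) => ℝ)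
      (Fin.last m)).symm p = Fin.snoc (α := fun _ => ℝ) p.2 p.1 := by
    intro p
    simp [MeasurableEquiv.piFinSuccAbove]
    rfl
  simp only [hes]
  rw [Measure.volume_eq_prod, lintegral_prod]
  swap
  · exact ((hF.mul he).comp hsn).aemeasurable
  simp only [Fin.sum_univ_castSucc, Fin.snoc_castSucc, Fin.snoc_last]
  have h1 : ∀ᵐ r : ℝ, ∫⁻ y : Fin m → ℝ, F (Fin.snoc (α := fun _ => ℝ) y r) *
      ENNReal.ofReal (Real.exp (-(∑ i, y i ^ 2 + r ^ 2))) =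
      ∫⁻ t : Fin m → ℝ, F (Fin.snoc (α := fun _ => ℝ) t 1) *
        ENNReal.ofReal (|r| ^ m * Real.exp (-(1 + ∑ i, t i ^ 2) * r ^ 2)) := by
    have h0 : ∀ᵐ r : ℝ, r ≠ 0 := by simp [ae_iff, measure_singleton]
    filter_upwards [h0] with r hr
    have hmap := Measure.map_addHaar_smul (volume : Measure (Fin m → ℝ)) hr
    rw [Module.finrank_fin_fun] at hmap
    have hvol : (volume : Measure (Fin m → ℝ)) = ENNReal.ofReal (|r| ^ m) •
        Measure.map (fun x => r • x) (volume : Measure (Fin m → ℝ)) := by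
      rw [hmap, smul_smul, ← ENNReal.ofReal_mul (by positivity), abs_inv, abs_pow,
        mul_inv_cancel₀ (by positivity)]
      simp
    conv_lhs => rw [hvol]
    rw [lintegral_smul_measure, lintegral_map, smul_eq_mul, ← lintegral_const_mul']
    · refine lintegral_congr fun t => ?_
      rw [hh t r hr, ENNReal.ofReal_mul (by positivity)]
      have : -(∑ i, (r • t) i ^ 2 + r ^ 2) = -(1 + ∑ i, t i ^ 2) * r ^ 2 := by
        simp only [Pi.smul_apply, smul_eq_mul, mul_pow, ← Finset.mul_sum]; ring
      rw [this]; ring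
    · exact ENNReal.ofReal_ne_top
    · refine Measurable.mul (hF.comp (hsn.comp measurable_prodMk_left)) (by fun_prop)
    · fun_prop
  rw [lintegral_congr_ae h1, lintegral_lintegral_swap, ← lintegral_const_mul']
  · refine lintegral_congr fun t => ?_
    have hc : 0 < 1 + ∑ i, t i ^ 2 := by positivity
    rw [lintegral_const_mul _ (by fun_prop), lint_radial m hc, ENNReal.ofReal_mul
      (Real.Gamma_pos_of_pos (by positivity)).le]
    ring
  · exact ENNReal.ofReal_ne_top
  · refine Measurable.aemeasurable ?_
    refine Measurable.mul ?_ (by fun_prop)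
    exact hF.comp (hsn.comp (measurable_const.prodMk measurable_snd))

lemma measurable_abs' : Measurable (fun x : ℝ => |x|) := measurable_norm

lemma map_abs_vol : Measure.map (fun x : ℝ => |x|) volume =
    (2 : ℝ≥0∞) • (volume.restrict (Set.Ioi (0 : ℝ))) := by
  ext A hA
  rw [Measure.map_apply measurable_abs' hA, Measure.smul_apply, Measure.restrict_apply hA,
    smul_eq_mul]
  have hm : MeasurableSet ((fun x : ℝ => |x|) ⁻¹' A) := measurable_abs' hA
  rw [← measure_inter_add_sdiff _ (measurableSet_Ioi (a := (0 : ℝ)))]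
  have h1 : (fun x : ℝ => |x|) ⁻¹' A ∩ Set.Ioi 0 = A ∩ Set.Ioi 0 := by
    ext x; simp only [Set.mem_inter_iff, Set.mem_preimage, Set.mem_Ioi]
    constructor <;> (rintro ⟨h, h0⟩; rw [abs_of_pos h0] at *; exact ⟨h, h0⟩)
  have h2 : volume ((fun x : ℝ => |x|) ⁻¹' A \ Set.Ioi 0) = volume (A ∩ Set.Ioi 0) := by
    have h3 : (volume : Measure ℝ) ((fun x : ℝ => |x|) ⁻¹' A \ Set.Ioi 0) =
        volume ((fun x : ℝ => |x|) ⁻¹' A ∩ Set.Iio 0) := by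
      refine measure_congr ?_
      have : ∀ᵐ x : ℝ, x ≠ 0 := by simp [ae_iff, measure_singleton]
      filter_upwards [this] with x hx
      refine propext ?_
      change (_ ∧ ¬ (0 < x)) ↔ (_ ∧ x < 0)
      rw [not_lt, le_iff_lt_or_eq]
      simp [hx]
    rw [h3, ← Measure.measure_neg]
    congr 1
    ext x; simp only [Set.mem_inter_iff, Set.mem_preimage, Set.mem_Ioi, Set.mem_neg, Set.mem_Iio,
      abs_neg, Left.neg_neg_iff]
    constructor <;> (rintro ⟨h, h0⟩; rw [abs_of_pos h0] at *; exact ⟨h, h0⟩)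
  rw [h1, h2, two_mul]

lemma map_abs_pi (m : ℕ) : Measure.map (fun (x : Fin m → ℝ) i => |x i|) volume =
    (2 : ℝ≥0∞) ^ m • (volume.restrict (Set.univ.pi fun _ => Set.Ioi (0 : ℝ))) := by
  have hs : SigmaFinite (Measure.map (fun x : ℝ => |x|) volume) := by
    rw [map_abs_vol]
    have : (2 : ℝ≥0∞) = ((2 : ℝ≥0) : ℝ≥0∞) := rfl
    rw [this]
    exact inferInstanceAs (SigmaFinite ((2 : ℝ≥0) • (volume.restrict (Set.Ioi (0 : ℝ)))))
  rw [volume_pi, Measure.pi_map_pi (f := fun _ x => |x|) (fun _ => measurable_abs'.aemeasurable)]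
  refine Measure.pi_eq fun A hA => ?_
  rw [Measure.restrict_pi_pi, Measure.smul_apply, Measure.pi_pi, map_abs_vol]
  simp [Finset.prod_mul_distrib]

lemma lint_abs {m : ℕ} (F : (Fin m → ℝ) → ℝ≥0∞) (hF : Measurable F)
    (h : ∀ t, F t = F (fun i => |t i|)) :
    ∫⁻ t : Fin m → ℝ, F t = 2 ^ m * ∫⁻ t in Set.univ.pi fun _ => Set.Ioi (0 : ℝ), F t := by
  have : ∫⁻ t : Fin m → ℝ, F t = ∫⁻ t, F t ∂(Measure.map (fun (x : Fin m → ℝ) i => |x i|) volume) := by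
    rw [lintegral_map hF (by fun_prop)]
    exact lintegral_congr h
  rw [this, map_abs_pi, lintegral_smul_measure, smul_eq_mul]

/-! ### Interlacing and Lagrange interpolation -/

/-- open interlacing box -/
def slab {m : ℕ} (a : Fin (m + 1) → ℝ) : Set (Fin m → ℝ) :=
  {μ | ∀ i : Fin m, a i.succ < μ i ∧ μ i < a i.castSucc}

/-- squared coordinates -/
def ww {m : ℕ} (a : Fin (m + 1) → ℝ) (μ : Fin m → ℝ) (i : Fin (m + 1)) : ℝ :=
  ∏ j, (a i - μ j) / (a i - a (i.succAbove j))

lemma slab_ratio {m : ℕ} {a : Fin (m + 1) → ℝ} (ha : StrictAnti a) {μ : Fin m → ℝ}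
    (hμ : μ ∈ slab a) (i : Fin (m + 1)) (j : Fin m) :
    0 < (a i - μ j) / (a i - a (i.succAbove j)) := by
  rcases lt_or_ge j.castSucc i with h | h
  · rw [Fin.succAbove_of_castSucc_lt _ _ h]
    have h1 : a i ≤ a j.succ := ha.antitone (Fin.castSucc_lt_iff_succ_le.mp h)
    have h2 := (hμ j).1
    have h3 := ha h
    exact div_pos_of_neg_of_neg (by linarith) (by linarith)
  · rw [Fin.succAbove_of_le_castSucc _ _ h]
    have h1 : a j.castSucc ≤ a i := ha.antitone h
    have h2 := (hμ j).2
    have h3 : a j.succ < a j.castSucc := ha Fin.castSucc_lt_succ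
    exact div_pos (by linarith) (by linarith)

lemma slab_ne {m : ℕ} {a : Fin (m + 1) → ℝ} (ha : StrictAnti a) {μ : Fin m → ℝ}
    (hμ : μ ∈ slab a) (i : Fin (m + 1)) (j : Fin m) : a i - μ j ≠ 0 := by
  intro h
  have := slab_ratio ha hμ i j
  rw [h] at this; simp at this

lemma sub_succAbove_ne {m : ℕ} {a : Fin (m + 1) → ℝ} (ha : StrictAnti a)
    (i : Fin (m + 1)) (j : Fin m) : a i - a (i.succAbove j) ≠ 0 :=
  sub_ne_zero.mpr (ha.injective.ne (Fin.succAbove_ne i j).symm)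

lemma slab_strictAnti {m : ℕ} {a : Fin (m + 1) → ℝ} (ha : StrictAnti a) {μ : Fin m → ℝ}
    (hμ : μ ∈ slab a) : StrictAnti μ := by
  intro i j hij
  have h1 := (hμ i).1
  have h2 := (hμ j).2
  have h3 : a j.castSucc ≤ a i.succ := ha.antitone (by
    rw [Fin.le_iff_val_le_val]; simpa using hij)
  linarith

lemma ww_pos {m : ℕ} {a : Fin (m + 1) → ℝ} (ha : StrictAnti a) {μ : Fin m → ℝ}
    (hμ : μ ∈ slab a) (i : Fin (m + 1)) : 0 < ww a μ i :=
  Finset.prod_pos fun j _ => slab_ratio ha hμ i j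

lemma prod_erase_succAbove {m : ℕ} (f : Fin (m + 1) → ℝ) (i : Fin (m + 1)) :
    ∏ j ∈ Finset.univ.erase i, f j = ∏ j, f (i.succAbove j) := by
  symm
  refine Finset.prod_nbij (i.succAbove) ?_ ?_ ?_ ?_
  · intro j _; simp
  · exact (Fin.succAbove_right_injective).injOn
  · intro j hj
    simp only [Finset.coe_erase, Finset.coe_univ, Set.mem_sdiff, Set.mem_univ,
      Set.mem_singleton_iff, true_and] at hj
    obtain ⟨k, hk⟩ := Fin.exists_succAbove_eq hj
    exact ⟨k, by simp, hk⟩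
  · intro j _; rfl

lemma lagrange_sum {m : ℕ} {a : Fin (m + 1) → ℝ} (ha : StrictAnti a) (P : Polynomial ℝ)
    (hP : P.natDegree ≤ m) :
    ∑ i, P.eval (a i) / ∏ j, (a i - a (i.succAbove j)) = P.coeff m := by
  have h := Lagrange.coeff_eq_sum (s := (Finset.univ : Finset (Fin (m + 1)))) (v := a)
    (ha.injective.injOn) (P := P) (by
      refine lt_of_le_of_lt Polynomial.degree_le_natDegree ?_
      simp only [Finset.card_univ, Fintype.card_fin]
      exact_mod_cast Nat.lt_succ_of_le hP)
  simp only [Finset.card_univ, Fintype.card_fin, Nat.add_sub_cancel] at h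
  rw [h]
  refine Finset.sum_congr rfl fun i _ => ?_
  rw [prod_erase_succAbove (fun j => a i - a j)]

lemma ww_eq {m : ℕ} (a : Fin (m + 1) → ℝ) (μ : Fin m → ℝ) (i : Fin (m + 1)) :
    ww a μ i = (∏ j, (a i - μ j)) / ∏ j, (a i - a (i.succAbove j)) := by
  rw [ww, Finset.prod_div_distrib]

lemma sum_ww {m : ℕ} {a : Fin (m + 1) → ℝ} (ha : StrictAnti a) (μ : Fin m → ℝ) :
    ∑ i, ww a μ i = 1 := by
  have hd : (∏ j, (Polynomial.X - Polynomial.C (μ j))).natDegree = m := by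
    rw [Polynomial.natDegree_finsetProd_X_sub_C_eq_card]; simp
  have h := lagrange_sum ha (∏ j, (Polynomial.X - Polynomial.C (μ j))) hd.le
  have hm : (∏ j, (Polynomial.X - Polynomial.C (μ j))).Monic :=
    Polynomial.monic_prod_X_sub_C _ _
  have hc := hm.coeff_natDegree
  rw [hd] at hc
  rw [hc] at h
  rw [← h]
  refine Finset.sum_congr rfl fun i _ => ?_
  rw [ww_eq, Polynomial.eval_prod]; simp

lemma sum_ww_div {m : ℕ} {a : Fin (m + 1) → ℝ} (ha : StrictAnti a) {μ : Fin m → ℝ}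
    (hμ : μ ∈ slab a) (j : Fin m) :
    ∑ i, ww a μ i / (a i - μ j) = 0 := by
  have hd : (∏ k ∈ Finset.univ.erase j, (Polynomial.X - Polynomial.C (μ k))).natDegree < m := by
    rw [Polynomial.natDegree_finsetProd_X_sub_C_eq_card]
    simp only [Finset.mem_univ, Finset.card_erase_of_mem, Finset.card_univ, Fintype.card_fin]
    have := j.pos; omega
  have h := lagrange_sum ha _ hd.le
  rw [Polynomial.coeff_eq_zero_of_natDegree_lt hd] at h
  rw [← h]
  refine Finset.sum_congr rfl fun i _ => ?_
  rw [ww_eq, Polynomial.eval_prod, ← Finset.mul_prod_erase _ _ (Finset.mem_univ j)]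
  have := slab_ne ha hμ i j
  simp only [Polynomial.eval_sub, Polynomial.eval_X, Polynomial.eval_C]
  field_simp

lemma ww_inj {m : ℕ} {a : Fin (m + 1) → ℝ} (ha : StrictAnti a) {μ μ' : Fin m → ℝ}
    (hμ : μ ∈ slab a) (hμ' : μ' ∈ slab a) (h : ∀ i, ww a μ i = ww a μ' i) : μ = μ' := by
  have hd : ∀ μ : Fin m → ℝ,
      (∏ j, (Polynomial.X - Polynomial.C (μ j))).degree <
        ((Finset.univ : Finset (Fin (m + 1))).card : WithBot ℕ) := by
    intro μ
    refine lt_of_le_of_lt Polynomial.degree_le_natDegree ?_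
    rw [Polynomial.natDegree_finsetProd_X_sub_C_eq_card]
    simp only [Finset.card_univ, Fintype.card_fin]
    exact_mod_cast Nat.lt_succ_self m
  have hP := Polynomial.eq_of_degrees_lt_of_eval_index_eq (v := a) Finset.univ
    ha.injective.injOn (hd μ) (hd μ') (by
      intro i _
      have h1 := h i
      rw [ww_eq, ww_eq, div_left_inj' (Finset.prod_ne_zero_iff.mpr
        fun j _ => sub_succAbove_ne ha i j)] at h1
      simpa [Polynomial.eval_prod] using h1)
  ext k
  have h2 := congrArg (Polynomial.eval (μ k)) hP
  rw [Polynomial.eval_prod, Polynomial.eval_prod,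
    Finset.prod_eq_zero (Finset.mem_univ k) (by simp)] at h2
  obtain ⟨j, _, hj⟩ := Finset.prod_eq_zero_iff.mp h2.symm
  simp only [Polynomial.eval_sub, Polynomial.eval_X, Polynomial.eval_C] at hj
  have hj' : μ k = μ' j := by linarith
  rcases lt_trichotomy j k with h3 | h3 | h3
  · exfalso
    have h4 : a k.castSucc ≤ a j.succ := ha.antitone (by
      rw [Fin.le_iff_val_le_val]; simpa using h3)
    linarith [(hμ k).2, (hμ' j).1]
  · rw [hj', h3]
  · exfalso
    have h4 : a j.castSucc ≤ a k.succ := ha.antitone (by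
      rw [Fin.le_iff_val_le_val]; simpa using h3)
    linarith [(hμ k).1, (hμ' j).2]

lemma ww_surj {m : ℕ} {a : Fin (m + 1) → ℝ} (ha : StrictAnti a) (y : Fin (m + 1) → ℝ)
    (hy : ∀ i, 0 < y i) (hy1 : ∑ i, y i = 1) : ∃ μ ∈ slab a, ∀ i, ww a μ i = y i := by
  let P : Polynomial ℝ := ∑ i, Polynomial.C (y i) *
    ∏ j, (Polynomial.X - Polynomial.C (a (i.succAbove j)))
  have hPe : ∀ i, P.eval (a i) = y i * ∏ j, (a i - a (i.succAbove j)) := by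
    intro i
    simp only [P, Polynomial.eval_finsetSum, Polynomial.eval_mul, Polynomial.eval_C,
      Polynomial.eval_prod, Polynomial.eval_sub, Polynomial.eval_X]
    refine Finset.sum_eq_single i (fun k _ hk => ?_) (by simp)
    obtain ⟨j, hj⟩ := Fin.exists_succAbove_eq hk.symm
    rw [Finset.prod_eq_zero (Finset.mem_univ j) (by rw [hj]; simp), mul_zero]
  have hsign : ∀ j : Fin m, P.eval (a j.castSucc) * P.eval (a j.succ) < 0 := by
    intro j
    rw [hPe, hPe]
    have h1 : (∏ l, (a j.castSucc - a (j.castSucc.succAbove l))) *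
        (∏ l, (a j.succ - a (j.succ.succAbove l))) < 0 := by
      rw [← Finset.prod_mul_distrib, ← Finset.mul_prod_erase _ _ (Finset.mem_univ j)]
      refine mul_neg_of_neg_of_pos ?_ (Finset.prod_pos fun l hl => ?_)
      · rw [Fin.succAbove_castSucc_self, Fin.succAbove_succ_self]
        have h3 : a j.succ < a j.castSucc := ha Fin.castSucc_lt_succ
        nlinarith
      · have hlj : l ≠ j := Finset.ne_of_mem_erase hl
        rcases lt_or_gt_of_ne hlj with h | h
        · rw [Fin.succAbove_of_castSucc_lt _ _ (by simpa using h),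
            Fin.succAbove_of_castSucc_lt _ _ (by
              rw [Fin.lt_def]; simp only [Fin.val_castSucc, Fin.val_succ]
              have := Fin.lt_def.mp h; omega)]
          refine mul_pos_of_neg_of_neg (sub_neg.mpr (ha (by simpa using h)))
            (sub_neg.mpr (ha ?_))
          rw [Fin.lt_def]; simp only [Fin.val_castSucc, Fin.val_succ]
          have := Fin.lt_def.mp h; omega
        · have h' := Fin.lt_def.mp h
          rw [Fin.succAbove_of_le_castSucc _ _ (by simpa using h.le),
            Fin.succAbove_of_le_castSucc _ _ (by
              rw [Fin.le_def]; simp only [Fin.val_castSucc, Fin.val_succ]; omega)]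
          refine mul_pos (sub_pos.mpr (ha ?_)) (sub_pos.mpr (ha ?_))
          · rw [Fin.lt_def]; simp only [Fin.val_castSucc, Fin.val_succ]; omega
          · rw [Fin.lt_def]; simp only [Fin.val_succ]; omega
    have h2 := mul_pos (hy j.castSucc) (hy j.succ)
    nlinarith [mul_neg_of_pos_of_neg h2 h1]
  have hroot : ∀ j : Fin m, ∃ x, (a j.succ < x ∧ x < a j.castSucc) ∧ P.eval x = 0 := by
    intro j
    have h3 : a j.succ < a j.castSucc := ha Fin.castSucc_lt_succ
    have hc : ContinuousOn (fun x => P.eval x) (Set.Icc (a j.succ) (a j.castSucc)) :=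
      P.continuous.continuousOn
    rcases mul_neg_iff.mp (hsign j) with h | h
    · obtain ⟨x, hx, hx0⟩ := intermediate_value_Ioo h3.le hc (show (0:ℝ) ∈ _ from ⟨h.2, h.1⟩)
      exact ⟨x, hx, hx0⟩
    · obtain ⟨x, hx, hx0⟩ := intermediate_value_Ioo' h3.le hc (show (0:ℝ) ∈ _ from ⟨h.1, h.2⟩)
      exact ⟨x, hx, hx0⟩
  choose μ hμ hμ0 using hroot
  have hμs : μ ∈ slab a := hμ
  refine ⟨μ, hμs, fun i => ?_⟩
  have hQd : ∀ f : Fin m → ℝ, (∏ j, (Polynomial.X - Polynomial.C (f j))).natDegree = m := by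
    intro f; rw [Polynomial.natDegree_finsetProd_X_sub_C_eq_card]; simp
  have hQm : ∀ f : Fin m → ℝ, (∏ j, (Polynomial.X - Polynomial.C (f j))).coeff m = 1 := by
    intro f
    have hm : (∏ j, (Polynomial.X - Polynomial.C (f j))).Monic :=
      Polynomial.monic_prod_X_sub_C _ _
    have := hm.coeff_natDegree
    rwa [hQd f] at this
  have hPd : P.natDegree ≤ m := by
    refine Polynomial.natDegree_sum_le_of_forall_le _ _ fun i _ => ?_
    refine (Polynomial.natDegree_C_mul_le _ _).trans (hQd _).le
  have hPm : P.coeff m = 1 := by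
    simp only [P, Polynomial.finsetSum_coeff, Polynomial.coeff_C_mul, hQm, mul_one, hy1]
  have hPQ : P = ∏ j, (Polynomial.X - Polynomial.C (μ j)) := by
    refine Polynomial.eq_of_degree_sub_lt_of_eval_index_eq (v := μ) Finset.univ
      (slab_strictAnti ha hμs).injective.injOn ?_ ?_
    · simp only [Finset.card_univ, Fintype.card_fin]
      rw [Polynomial.degree_lt_iff_coeff_zero]
      intro k hk
      rcases hk.eq_or_lt with h | h
      · rw [← h, Polynomial.coeff_sub, hPm, hQm, sub_self]
      · rw [Polynomial.coeff_sub, Polynomial.coeff_eq_zero_of_natDegree_lt (hPd.trans_lt h),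
          Polynomial.coeff_eq_zero_of_natDegree_lt ((hQd μ).le.trans_lt h), sub_self]
    · intro j _
      rw [hμ0, Polynomial.eval_prod, Finset.prod_eq_zero (Finset.mem_univ j) (by simp)]
  have h1 := hPe i
  rw [hPQ, Polynomial.eval_prod] at h1
  simp only [Polynomial.eval_sub, Polynomial.eval_X, Polynomial.eval_C] at h1
  rw [ww_eq, h1, mul_div_cancel_right₀]
  exact Finset.prod_ne_zero_iff.mpr fun j _ => sub_succAbove_ne ha i j

/-! ### Diagonalizing the corner -/

/-- squared norms of eigenvectors -/
def nn2 {m : ℕ} (a : Fin (m + 1) → ℝ) (μ : Fin m → ℝ) (j : Fin m) : ℝ :=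
  ∑ i, ww a μ i / (a i - μ j) ^ 2

/-- the orthogonal matrix of corner eigenvectors -/
def V0 {m : ℕ} (a : Fin (m + 1) → ℝ) (μ : Fin m → ℝ) : Matrix (Fin (m + 1)) (Fin (m + 1)) ℝ :=
  Matrix.of fun l i => Fin.lastCases (motive := fun _ => ℝ) (√(ww a μ i))
    (fun j => √(ww a μ i) / ((a i - μ j) * √(nn2 a μ j))) l

@[simp] lemma V0_last {m : ℕ} (a : Fin (m + 1) → ℝ) (μ : Fin m → ℝ) (i : Fin (m + 1)) :
    V0 a μ (Fin.last m) i = √(ww a μ i) := by simp [V0]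
@[simp] lemma V0_cast {m : ℕ} (a : Fin (m + 1) → ℝ) (μ : Fin m → ℝ) (j : Fin m)
    (i : Fin (m + 1)) :
    V0 a μ j.castSucc i = √(ww a μ i) / ((a i - μ j) * √(nn2 a μ j)) := by simp [V0]

lemma nn2_pos {m : ℕ} {a : Fin (m + 1) → ℝ} (ha : StrictAnti a) {μ : Fin m → ℝ}
    (hμ : μ ∈ slab a) (j : Fin m) : 0 < nn2 a μ j :=
  Finset.sum_pos (fun i _ => div_pos (ww_pos ha hμ i)
    (by have := slab_ne ha hμ i j; positivity)) Finset.univ_nonempty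

lemma sum_ww_div2 {m : ℕ} {a : Fin (m + 1) → ℝ} (ha : StrictAnti a) {μ : Fin m → ℝ}
    (hμ : μ ∈ slab a) {j k : Fin m} (hjk : j ≠ k) :
    ∑ i, ww a μ i / ((a i - μ j) * (a i - μ k)) = 0 := by
  have hne : μ j - μ k ≠ 0 := sub_ne_zero.mpr ((slab_strictAnti ha hμ).injective.ne hjk)
  have h : ∀ i, ww a μ i / ((a i - μ j) * (a i - μ k)) =
      (ww a μ i / (a i - μ j) - ww a μ i / (a i - μ k)) / (μ j - μ k) := by
    intro i
    have h1 := slab_ne ha hμ i j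
    have h2 := slab_ne ha hμ i k
    field_simp
    ring
  simp only [h]
  rw [← Finset.sum_div, Finset.sum_sub_distrib, sum_ww_div ha hμ, sum_ww_div ha hμ]
  simp

lemma V0_cc {m : ℕ} {a : Fin (m + 1) → ℝ} (ha : StrictAnti a) {μ : Fin m → ℝ}
    (hμ : μ ∈ slab a) (j k : Fin m) (i : Fin (m + 1)) :
    V0 a μ j.castSucc i * V0 a μ k.castSucc i =
      ww a μ i / ((a i - μ j) * (a i - μ k)) / (√(nn2 a μ j) * √(nn2 a μ k)) := by
  have h0 := Real.mul_self_sqrt (ww_pos ha hμ i).le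
  have h1 := slab_ne ha hμ i j
  have h2 := slab_ne ha hμ i k
  have h3 := (Real.sqrt_pos.mpr (nn2_pos ha hμ j)).ne'
  have h4 := (Real.sqrt_pos.mpr (nn2_pos ha hμ k)).ne'
  rw [V0_cast, V0_cast, div_mul_div_comm, h0]
  field_simp

lemma V0_sum_cc {m : ℕ} {a : Fin (m + 1) → ℝ} (ha : StrictAnti a) {μ : Fin m → ℝ}
    (hμ : μ ∈ slab a) (j k : Fin m) :
    ∑ i, V0 a μ j.castSucc i * V0 a μ k.castSucc i = if j = k then 1 else 0 := by
  simp only [V0_cc ha hμ]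
  rw [← Finset.sum_div]
  split_ifs with h
  · subst h
    rw [Real.mul_self_sqrt (nn2_pos ha hμ j).le]
    have : ∑ i, ww a μ i / ((a i - μ j) * (a i - μ j)) = nn2 a μ j := by
      unfold nn2; simp only [sq]
    rw [this, div_self (nn2_pos ha hμ j).ne']
  · rw [sum_ww_div2 ha hμ h, zero_div]

lemma V0_sum_lc {m : ℕ} {a : Fin (m + 1) → ℝ} (ha : StrictAnti a) {μ : Fin m → ℝ}
    (hμ : μ ∈ slab a) (k : Fin m) :
    ∑ i, V0 a μ (Fin.last m) i * V0 a μ k.castSucc i = 0 := by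
  have h : ∀ i, V0 a μ (Fin.last m) i * V0 a μ k.castSucc i =
      ww a μ i / (a i - μ k) / √(nn2 a μ k) := by
    intro i
    have h0 := Real.mul_self_sqrt (ww_pos ha hμ i).le
    rw [V0_last, V0_cast, ← mul_div_assoc, h0, div_div]
  simp only [h]
  rw [← Finset.sum_div, sum_ww_div ha hμ, zero_div]

lemma V0_orth {m : ℕ} {a : Fin (m + 1) → ℝ} (ha : StrictAnti a) {μ : Fin m → ℝ}
    (hμ : μ ∈ slab a) : V0 a μ ∈ Matrix.orthogonalGroup (Fin (m + 1)) ℝ := by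
  rw [Matrix.mem_orthogonalGroup_iff]
  ext l l'
  simp only [Matrix.mul_apply, Matrix.star_eq_conjTranspose, Matrix.conjTranspose_apply,
    Matrix.transpose_apply, star_trivial]
  induction l using Fin.lastCases with
  | last =>
    induction l' using Fin.lastCases with
    | last =>
      simp only [V0_last, Real.mul_self_sqrt (ww_pos ha hμ _).le, Matrix.one_apply_eq]
      exact sum_ww ha μ
    | cast k =>
      rw [V0_sum_lc ha hμ, Matrix.one_apply_ne (Fin.castSucc_lt_last k).ne']
  | cast j =>
    induction l' using Fin.lastCases with
    | last =>
      rw [Matrix.one_apply_ne (Fin.castSucc_lt_last j).ne, ← V0_sum_lc ha hμ j]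
      exact Finset.sum_congr rfl fun i _ => mul_comm _ _
    | cast k =>
      rw [V0_sum_cc ha hμ]
      simp [Matrix.one_apply]

lemma V0_diag {m : ℕ} {a : Fin (m + 1) → ℝ} (ha : StrictAnti a) {μ : Fin m → ℝ}
    (hμ : μ ∈ slab a) (j k : Fin m) :
    ∑ i, a i * (V0 a μ j.castSucc i * V0 a μ k.castSucc i) = if j = k then μ j else 0 := by
  have h : ∀ i, a i * (V0 a μ j.castSucc i * V0 a μ k.castSucc i) =
      ww a μ i / (a i - μ k) / (√(nn2 a μ j) * √(nn2 a μ k)) +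
        μ j * (V0 a μ j.castSucc i * V0 a μ k.castSucc i) := by
    intro i
    have h1 := slab_ne ha hμ i j
    have h2 := slab_ne ha hμ i k
    have h3 := (Real.sqrt_pos.mpr (nn2_pos ha hμ j)).ne'
    have h4 := (Real.sqrt_pos.mpr (nn2_pos ha hμ k)).ne'
    rw [V0_cc ha hμ]
    field_simp
    ring
  simp only [h]
  rw [Finset.sum_add_distrib, ← Finset.sum_div, sum_ww_div ha hμ, ← Finset.mul_sum,
    V0_sum_cc ha hμ]
  split_ifs <;> simp

lemma sum_a_ww {m : ℕ} {a : Fin (m + 1) → ℝ} (ha : StrictAnti a) {μ : Fin m → ℝ}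
    (hμ : μ ∈ slab a) : ∑ i, a i * ww a μ i = ∑ i, a i - ∑ j, μ j := by
  have h1 : ∀ i, ∑ l, V0 a μ l i * V0 a μ l i = 1 := by
    intro i
    have := congrFun (congrFun (orth_mul' (V0_orth ha hμ)) i) i
    simpa [Matrix.mul_apply] using this
  have h2 : ∑ i, a i = ∑ l, ∑ i, a i * (V0 a μ l i * V0 a μ l i) := by
    rw [Finset.sum_comm]
    refine Finset.sum_congr rfl fun i _ => ?_
    rw [← Finset.mul_sum, h1, mul_one]
  rw [Fin.sum_univ_castSucc (n := m) (f := fun l => ∑ i, a i * (V0 a μ l i * V0 a μ l i))] at h2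
  simp only [V0_diag ha hμ, if_true, V0_last, Real.mul_self_sqrt (ww_pos ha hμ _).le] at h2
  linarith

lemma qf_V0 {m : ℕ} (s : Fin (m + 1) → ℝ) {a : Fin (m + 1) → ℝ} (ha : StrictAnti a)
    {μ : Fin m → ℝ} (hμ : μ ∈ slab a) (W : Matrix (Fin m) (Fin m) ℝ) :
    qf s a (emb W * V0 a μ) =
      ENNReal.ofReal (Real.exp (s (Fin.last m) * (∑ i, a i - ∑ j, μ j))) *
        qf (fun l => s l.castSucc) μ W := by
  unfold qf
  rw [← ENNReal.ofReal_mul (Real.exp_pos _).le, ← Real.exp_add, Fin.sum_univ_castSucc]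
  have hl : ∑ i, a i * (emb W * V0 a μ) (Fin.last m) i ^ 2 = ∑ i, a i - ∑ j, μ j := by
    rw [← sum_a_ww ha hμ]
    refine Finset.sum_congr rfl fun i _ => ?_
    simp [Matrix.mul_apply, Fin.sum_univ_castSucc, Real.sq_sqrt (ww_pos ha hμ i).le]
  have hc : ∀ l : Fin m, ∑ i, a i * (emb W * V0 a μ) l.castSucc i ^ 2 =
      ∑ j, μ j * W l j ^ 2 := by
    intro l
    have e : ∀ i, a i * (emb W * V0 a μ) l.castSucc i ^ 2 =
        ∑ j, ∑ k, (W l j * W l k) * (a i * (V0 a μ j.castSucc i * V0 a μ k.castSucc i)) := by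
      intro i
      rw [Matrix.mul_apply, Fin.sum_univ_castSucc]
      simp only [emb_cc, emb_cl, zero_mul, add_zero]
      rw [sq, Finset.sum_mul_sum, Finset.mul_sum]
      refine Finset.sum_congr rfl fun j _ => ?_
      rw [Finset.mul_sum]
      exact Finset.sum_congr rfl fun k _ => by ring
    simp only [e]
    rw [Finset.sum_comm]
    refine Finset.sum_congr rfl fun j _ => ?_
    rw [Finset.sum_comm]
    simp only [← Finset.mul_sum, V0_diag ha hμ]
    rw [Finset.sum_eq_single j]
    · simp; ring
    · intro k _ hk; rw [if_neg hk.symm, mul_zero]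
    · simp
  simp only [hl, hc]
  rw [add_comm]

lemma Phi_slab {m : ℕ} (s : Fin (m + 1) → ℝ) {a : Fin (m + 1) → ℝ} (ha : StrictAnti a)
    {μ : Fin m → ℝ} (hμ : μ ∈ slab a) {κ : Measure (Matrix (Fin m) (Fin m) ℝ)}
    (hκ : IsHaarOrth m κ) (x : Fin (m + 1) → ℝ) (hx : 0 < ∑ j, x j ^ 2)
    (h : ∀ i, ww a μ i * (∑ j, x j ^ 2) = x i ^ 2) :
    Phi s a κ x = ENNReal.ofReal (Real.exp (s (Fin.last m) * (∑ i, a i - ∑ j, μ j))) *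
        ∫⁻ W, qf (fun l => s l.castSucc) μ W ∂κ := by
  rw [Phi_eq s a hκ x hx (V0_orth ha hμ) (by
    intro i; rw [V0_last, Real.sq_sqrt (ww_pos ha hμ i).le, h])]
  simp only [qf_V0 s ha hμ]
  rw [lintegral_const_mul _ (measurable_qf _ _)]

lemma Phi_congr {m : ℕ} (s a : Fin (m + 1) → ℝ) {κ : Measure (Matrix (Fin m) (Fin m) ℝ)}
    (hκ : IsHaarOrth m κ) (x y : Fin (m + 1) → ℝ) (hx : 0 < ∑ j, x j ^ 2) (c : ℝ) (hc : 0 < c)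
    (h : ∀ i, y i ^ 2 = c * x i ^ 2) : Phi s a κ y = Phi s a κ x := by
  have hy : ∑ j, y j ^ 2 = c * ∑ j, x j ^ 2 := by
    rw [Finset.mul_sum]; exact Finset.sum_congr rfl fun i _ => h i
  rw [Phi]
  symm
  refine Phi_eq s a hκ x hx (hh_orth y) ?_
  intro i
  have hy0 : 0 < ∑ j, y j ^ 2 := by rw [hy]; positivity
  rw [hh_row y hy0, div_pow, Real.sq_sqrt hy0.le, hy, h]
  field_simp

/-! ### Cauchy determinant and the change of variables -/

/-- absolute Vandermonde product -/
def VV {k : ℕ} (x : Fin k → ℝ) : ℝ := ∏ i, ∏ j ∈ Finset.Ioi i, |x j - x i|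

lemma VV_eq_det {k : ℕ} (x : Fin k → ℝ) : |(Matrix.vandermonde x).det| = VV x := by
  rw [Matrix.det_vandermonde, Finset.abs_prod]
  simp only [Finset.abs_prod, VV]

lemma VV_pos {k : ℕ} {x : Fin k → ℝ} (hx : Function.Injective x) : 0 < VV x :=
  Finset.prod_pos fun i _ => Finset.prod_pos fun j hj =>
    abs_pos.mpr (sub_ne_zero.mpr (hx.ne (Finset.mem_Ioi.mp hj).ne'))

lemma VV_sq {k : ℕ} (x : Fin k → ℝ) :
    ∏ i, ∏ j ∈ Finset.univ.erase i, |x i - x j| = VV x ^ 2 := by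
  have h : ∀ i : Fin k, ∏ j ∈ Finset.univ.erase i, |x i - x j| =
      (∏ j ∈ Finset.Iio i, |x i - x j|) * ∏ j ∈ Finset.Ioi i, |x i - x j| := by
    intro i
    rw [← Finset.prod_union]
    · congr 1
      ext j; simp
    · rw [Finset.disjoint_left]
      intro j h1 h2
      exact absurd (Finset.mem_Iio.mp h1) (not_lt.mpr (Finset.mem_Ioi.mp h2).le)
  simp only [h]
  rw [Finset.prod_mul_distrib, sq]
  congr 1
  · unfold VV
    exact Finset.prod_comm' (by simp)
  · unfold VV
    exact Finset.prod_congr rfl fun i _ => Finset.prod_congr rfl fun j _ => abs_sub_comm _ _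

lemma abs_det_B {k : ℕ} (x μ : Fin k → ℝ) (hμ : Function.Injective μ) :
    |(Matrix.of fun i j => ∏ l ∈ Finset.univ.erase j, (x i - μ l)).det| = VV x * VV μ := by
  let Q : Fin k → Polynomial ℝ := fun j =>
    ∏ l ∈ Finset.univ.erase j, (Polynomial.X - Polynomial.C (μ l))
  let Co : Matrix (Fin k) (Fin k) ℝ := Matrix.of fun l j => (Q j).coeff l
  have hfac : ∀ y : Fin k → ℝ,
      (Matrix.of fun i j => ∏ l ∈ Finset.univ.erase j, (y i - μ l)) =
        Matrix.vandermonde y * Co := by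
    intro y
    ext i j
    have hd : (Q j).natDegree < k := by
      simp only [Q]
      rw [Polynomial.natDegree_finsetProd_X_sub_C_eq_card]
      simp only [Finset.mem_univ, Finset.card_erase_of_mem, Finset.card_univ, Fintype.card_fin]
      have := j.pos; omega
    have he : (Q j).eval (y i) = ∏ l ∈ Finset.univ.erase j, (y i - μ l) := by
      simp [Q, Polynomial.eval_prod]
    rw [Matrix.of_apply, ← he, Polynomial.eval_eq_sum_range' hd, Finset.sum_range,
      Matrix.mul_apply]
    refine Finset.sum_congr rfl fun l _ => ?_
    simp [Co, Matrix.vandermonde_apply, mul_comm]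
  have h1 : VV μ * |Co.det| = VV μ ^ 2 := by
    rw [← VV_eq_det, ← abs_mul, ← Matrix.det_mul, ← hfac μ, VV_eq_det, ← VV_sq]
    have : (Matrix.of fun i j => ∏ l ∈ Finset.univ.erase j, (μ i - μ l)) =
        Matrix.diagonal fun i => ∏ l ∈ Finset.univ.erase i, (μ i - μ l) := by
      ext i j
      by_cases hij : i = j
      · subst hij; simp
      · rw [Matrix.diagonal_apply_ne _ hij, Matrix.of_apply]
        exact Finset.prod_eq_zero (Finset.mem_erase.mpr ⟨hij, Finset.mem_univ i⟩) (sub_self _)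
    rw [this, Matrix.det_diagonal, Finset.abs_prod]
    simp only [Finset.abs_prod]
  have h2 : |Co.det| = VV μ := by
    have := VV_pos hμ
    rw [sq] at h1
    exact mul_left_cancel₀ this.ne' h1
  rw [hfac x, Matrix.det_mul, abs_mul, VV_eq_det, h2]

lemma abs_det_cauchy {k : ℕ} (x μ : Fin k → ℝ) (hμ : Function.Injective μ)
    (hne : ∀ i j, x i - μ j ≠ 0) :
    |(Matrix.of fun i j => (x i - μ j)⁻¹).det| =
      VV x * VV μ / ∏ i, ∏ j, |x i - μ j| := by
  have : (Matrix.of fun i j => (x i - μ j)⁻¹) =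
      Matrix.diagonal (fun i => (∏ j, (x i - μ j))⁻¹) *
        (Matrix.of fun i j => ∏ l ∈ Finset.univ.erase j, (x i - μ l)) := by
    ext i j
    rw [Matrix.diagonal_mul, Matrix.of_apply, Matrix.of_apply,
      ← Finset.mul_prod_erase _ _ (Finset.mem_univ j)]
    have h1 := hne i j
    have h2 : ∏ l ∈ Finset.univ.erase j, (x i - μ l) ≠ 0 :=
      Finset.prod_ne_zero_iff.mpr fun l _ => hne i l
    field_simp
  rw [this, Matrix.det_mul, abs_mul, abs_det_B x μ hμ, Matrix.det_diagonal,
    Finset.prod_inv_distrib, abs_inv, Finset.abs_prod]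
  simp only [Finset.abs_prod]
  rw [div_eq_inv_mul]

lemma VV_castSucc {m : ℕ} (a : Fin (m + 1) → ℝ) :
    VV a = VV (fun i : Fin m => a i.castSucc) * ∏ i : Fin m, |a i.castSucc - a (Fin.last m)| := by
  unfold VV
  rw [Fin.prod_univ_castSucc, ← Finset.prod_mul_distrib]
  have hl : Finset.Ioi (Fin.last m) = ∅ := by
    ext j; simp [Fin.le_last]
  rw [hl, Finset.prod_empty, mul_one]
  refine Finset.prod_congr rfl fun i _ => ?_
  have : Finset.Ioi i.castSucc = insert (Fin.last m) ((Finset.Ioi i).map Fin.castSuccEmb) := by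
    ext j
    induction j using Fin.lastCases with
    | last => simp [Fin.castSucc_lt_last]
    | cast j =>
      simp
      exact fun _ => Fin.le_last _
  rw [this, Finset.prod_insert, Finset.prod_map, mul_comm, abs_sub_comm]
  · rfl
  · simp [Fin.castSucc_ne_last]

/-- the projective coordinates -/
def tt {m : ℕ} (a : Fin (m + 1) → ℝ) (μ : Fin m → ℝ) (i : Fin m) : ℝ :=
  Real.exp (∑ j, (Real.log (a i.castSucc - μ j) - Real.log (a i.castSucc -
    a (i.castSucc.succAbove j)) - (Real.log (a (Fin.last m) - μ j) -
    Real.log (a (Fin.last m) - a ((Fin.last m).succAbove j)))) / 2)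

lemma tt_pos {m : ℕ} (a : Fin (m + 1) → ℝ) (μ : Fin m → ℝ) (i : Fin m) : 0 < tt a μ i :=
  Real.exp_pos _

lemma tt_sq {m : ℕ} {a : Fin (m + 1) → ℝ} (ha : StrictAnti a) {μ : Fin m → ℝ}
    (hμ : μ ∈ slab a) (i : Fin m) :
    tt a μ i ^ 2 = ww a μ i.castSucc / ww a μ (Fin.last m) := by
  rw [tt, ← Real.exp_nat_mul, ← Finset.sum_div]
  have h : ∀ i j, Real.log (a i - μ j) - Real.log (a i - a (i.succAbove j)) =
      Real.log ((a i - μ j) / (a i - a (i.succAbove j))) := fun i j =>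
    (Real.log_div (slab_ne ha hμ i j) (sub_succAbove_ne ha i j)).symm
  simp only [h]
  rw [Finset.sum_sub_distrib, ← Real.log_prod (fun j _ => (slab_ratio ha hμ _ j).ne'),
    ← Real.log_prod (fun j _ => (slab_ratio ha hμ _ j).ne')]
  change Real.exp (_ * ((Real.log (ww a μ _) - Real.log (ww a μ _)) / 2)) = _
  rw [Nat.cast_ofNat, mul_div_cancel₀ _ (two_ne_zero), Real.exp_sub, Real.exp_log (ww_pos ha hμ _),
    Real.exp_log (ww_pos ha hμ _)]

lemma one_add_tt {m : ℕ} {a : Fin (m + 1) → ℝ} (ha : StrictAnti a) {μ : Fin m → ℝ}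
    (hμ : μ ∈ slab a) : 1 + ∑ i, tt a μ i ^ 2 = (ww a μ (Fin.last m))⁻¹ := by
  simp only [tt_sq ha hμ]
  have h := sum_ww ha μ
  rw [Fin.sum_univ_castSucc] at h
  have := (ww_pos ha hμ (Fin.last m)).ne'
  rw [← Finset.sum_div]
  field_simp
  linarith

/-- Jacobian matrix -/
def DM {m : ℕ} (a : Fin (m + 1) → ℝ) (μ : Fin m → ℝ) : Matrix (Fin m) (Fin m) ℝ :=
  Matrix.of fun i j => tt a μ i * (((a (Fin.last m) - μ j)⁻¹ - (a i.castSucc - μ j)⁻¹) / 2)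

lemma tt_deriv {m : ℕ} {a : Fin (m + 1) → ℝ} (ha : StrictAnti a) {μ : Fin m → ℝ}
    (hμ : μ ∈ slab a) :
    HasFDerivAt (tt a) (LinearMap.toContinuousLinearMap (Matrix.toLin' (DM a μ))) μ := by
  rw [hasFDerivAt_pi']
  intro i
  have hsub : ∀ (c : ℝ) (j : Fin m), HasFDerivAt (fun ν : Fin m → ℝ => c - ν j)
      (-(ContinuousLinearMap.proj (R := ℝ) (φ := fun _ : Fin m => ℝ) j)) μ := fun c j =>
    (hasFDerivAt_apply j μ).const_sub c
  have hlog : ∀ (i : Fin (m + 1)) (j : Fin m), HasFDerivAt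
      (fun ν : Fin m → ℝ => Real.log (a i - ν j)) ((a i - μ j)⁻¹ •
      (-(ContinuousLinearMap.proj (R := ℝ) (φ := fun _ : Fin m => ℝ) j))) μ := fun i j =>
    (hsub (a i) j).log (slab_ne ha hμ i j)
  have hterm : ∀ j : Fin m, HasFDerivAt (fun ν : Fin m → ℝ =>
      (Real.log (a i.castSucc - ν j) - Real.log (a i.castSucc -
    a (i.castSucc.succAbove j)) - (Real.log (a (Fin.last m) - ν j) -
    Real.log (a (Fin.last m) - a ((Fin.last m).succAbove j)))) / 2)
      ((((a (Fin.last m) - μ j)⁻¹ - (a i.castSucc - μ j)⁻¹) / 2) •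
        (ContinuousLinearMap.proj (R := ℝ) (φ := fun _ : Fin m => ℝ) j)) μ := by
    intro j
    have := ((((hlog i.castSucc j).sub_const (Real.log (a i.castSucc -
      a (i.castSucc.succAbove j)))).sub ((hlog (Fin.last m) j).sub_const
      (Real.log (a (Fin.last m) - a ((Fin.last m).succAbove j))))).mul_const (2:ℝ)⁻¹)
    simp only [← div_eq_mul_inv] at this
    refine this.congr_fderiv ?_
    ext v
    simp
    ring
  have hsum := HasFDerivAt.fun_sum (u := Finset.univ) fun j _ => hterm j
  have hexp := hsum.exp
  refine hexp.congr_fderiv ?_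
  ext v
  simp only [ContinuousLinearMap.comp_apply, LinearMap.coe_toContinuousLinearMap',
    Matrix.toLin'_apply, ContinuousLinearMap.proj_apply, Matrix.mulVec, dotProduct, DM,
    Matrix.of_apply, ContinuousLinearMap.smul_apply, ContinuousLinearMap.sum_apply, smul_eq_mul,
    tt, Finset.mul_sum, mul_assoc]

lemma det_DM {m : ℕ} {a : Fin (m + 1) → ℝ} (ha : StrictAnti a) {μ : Fin m → ℝ}
    (hμ : μ ∈ slab a) :
    2 ^ m * |(DM a μ).det| = (∏ i, tt a μ i) * (VV a * VV μ / ∏ i, ∏ j, |a i - μ j|) := by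
  have hfac : DM a μ = Matrix.diagonal (fun i => tt a μ i * ((a i.castSucc - a (Fin.last m)) / 2)) *
      (Matrix.of fun i j => (a (Fin.castSucc i) - μ j)⁻¹) *
      Matrix.diagonal (fun j => (a (Fin.last m) - μ j)⁻¹) := by
    ext i j
    rw [Matrix.mul_diagonal, Matrix.diagonal_mul, DM, Matrix.of_apply, Matrix.of_apply]
    have h1 := slab_ne ha hμ i.castSucc j
    have h2 := slab_ne ha hμ (Fin.last m) j
    field_simp
    ring
  rw [hfac, Matrix.det_mul, Matrix.det_mul, abs_mul, abs_mul, Matrix.det_diagonal,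
    Matrix.det_diagonal, abs_det_cauchy _ μ (slab_strictAnti ha hμ).injective
      (fun i j => slab_ne ha hμ _ _), VV_castSucc a, Fin.prod_univ_castSucc, Finset.abs_prod,
    Finset.abs_prod]
  simp only [abs_mul, abs_div, abs_inv, Finset.prod_mul_distrib, Finset.prod_div_distrib,
    Finset.prod_inv_distrib, abs_of_pos (tt_pos a μ _)]
  simp only [abs_two, Finset.prod_const, Finset.card_univ, Fintype.card_fin]
  have h3 : ∏ j, |a (Fin.last m) - μ j| ≠ 0 :=
    Finset.prod_ne_zero_iff.mpr fun j _ => abs_ne_zero.mpr (slab_ne ha hμ _ j)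
  have h4 : ∏ i : Fin m, ∏ j, |a i.castSucc - μ j| ≠ 0 :=
    Finset.prod_ne_zero_iff.mpr fun i _ => Finset.prod_ne_zero_iff.mpr
      fun j _ => abs_ne_zero.mpr (slab_ne ha hμ _ j)
  field_simp

lemma prod_ww {m : ℕ} {a : Fin (m + 1) → ℝ} (ha : StrictAnti a) {μ : Fin m → ℝ}
    (hμ : μ ∈ slab a) : ∏ i, ww a μ i = (∏ i, ∏ j, |a i - μ j|) / VV a ^ 2 := by
  rw [← VV_sq, ← Finset.prod_div_distrib]
  refine Finset.prod_congr rfl fun i _ => ?_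
  rw [prod_erase_succAbove (fun j => |a i - a j|), ← Finset.abs_prod, ← Finset.abs_prod, ← abs_div,
    ← ww_eq, abs_of_pos (ww_pos ha hμ i)]

lemma dens_eq {m : ℕ} {a : Fin (m + 1) → ℝ} (ha : StrictAnti a) {μ : Fin m → ℝ}
    (hμ : μ ∈ slab a) :
    2 ^ m * |(DM a μ).det| * (1 + ∑ i, tt a μ i ^ 2) ^ (-((m : ℝ) + 1) / 2) =
      VV μ / √(∏ i, ∏ j, |a i - μ j|) := by
  have hw := ww_pos ha hμ
  have hX : 0 < ∏ i, ∏ j, |a i - μ j| := Finset.prod_pos fun i _ => Finset.prod_pos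
      fun j _ => abs_pos.mpr (slab_ne ha hμ _ j)
  have hA := VV_pos ha.injective
  have ht : ∀ i, tt a μ i = √(ww a μ i.castSucc) / √(ww a μ (Fin.last m)) := by
    intro i
    rw [← Real.sqrt_div (hw _).le, ← tt_sq ha hμ, Real.sqrt_sq (tt_pos a μ i).le]
  have hp : (1 + ∑ i, tt a μ i ^ 2) ^ (-((m : ℝ) + 1) / 2) = √(ww a μ (Fin.last m)) ^ (m + 1) := by
    rw [one_add_tt ha hμ, ← Real.rpow_neg_one, ← Real.rpow_mul (hw _).le, Real.sqrt_eq_rpow,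
      ← Real.rpow_natCast, ← Real.rpow_mul (hw _).le]
    congr 1
    push_cast
    ring
  have hs : (∏ i, tt a μ i) * √(ww a μ (Fin.last m)) ^ (m + 1) =
      √(∏ i, ∏ j, |a i - μ j|) / VV a := by
    have h1 : (∏ i, √(ww a μ i)) = √(∏ i, ∏ j, |a i - μ j|) / VV a := by
      have h2 : √(∏ i, ∏ j, |a i - μ j|) / VV a = √(∏ i, ww a μ i) := by
        rw [prod_ww ha hμ, Real.sqrt_div hX.le, Real.sqrt_sq hA.le]
      rw [h2, Real.sqrt_eq_rpow, ← Real.finset_prod_rpow _ _ fun i _ => (hw i).le]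
      simp only [Real.sqrt_eq_rpow]
    rw [← h1, Fin.prod_univ_castSucc]
    simp only [ht, Finset.prod_div_distrib, Finset.prod_const, Finset.card_univ, Fintype.card_fin]
    have := (Real.sqrt_pos.mpr (hw (Fin.last m))).ne'
    field_simp
    ring
  rw [det_DM ha hμ, hp, mul_right_comm, hs]
  have hq := Real.sqrt_pos.mpr hX
  have hq2 := Real.mul_self_sqrt hX.le
  rw [div_mul_div_comm, div_eq_div_iff (by positivity) (by positivity)]
  linear_combination (VV a * VV μ) * hq2

lemma tt_injOn {m : ℕ} {a : Fin (m + 1) → ℝ} (ha : StrictAnti a) :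
    Set.InjOn (tt a) (slab a) := by
  intro μ hμ μ' hμ' h
  refine ww_inj ha hμ hμ' ?_
  have hl : ww a μ (Fin.last m) = ww a μ' (Fin.last m) := by
    have h1 := one_add_tt ha hμ
    rw [h, one_add_tt ha hμ'] at h1
    exact (inv_injective h1).symm
  intro i
  induction i using Fin.lastCases with
  | last => exact hl
  | cast i =>
    have h1 := tt_sq ha hμ i
    rw [h, tt_sq ha hμ', hl] at h1
    exact ((div_left_inj' (ww_pos ha hμ' _).ne').mp h1).symm

lemma tt_image {m : ℕ} {a : Fin (m + 1) → ℝ} (ha : StrictAnti a) :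
    tt a '' slab a = Set.univ.pi fun _ => Set.Ioi (0 : ℝ) := by
  ext t
  constructor
  · rintro ⟨μ, _, rfl⟩ i _
    exact tt_pos a μ i
  · intro ht
    have ht' : ∀ i, 0 < t i := fun i => ht i trivial
    have hS : 0 < 1 + ∑ i, t i ^ 2 := by positivity
    obtain ⟨μ, hμ, hw⟩ := ww_surj ha
      (fun i => Fin.lastCases (motive := fun _ => ℝ) (1 / (1 + ∑ i, t i ^ 2))
        (fun j => t j ^ 2 / (1 + ∑ i, t i ^ 2)) i) (by
        intro i
        induction i using Fin.lastCases with
        | last => simp only [Fin.lastCases_last]; positivity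
        | cast i => simp only [Fin.lastCases_castSucc]; have := ht' i; positivity) (by
        rw [Fin.sum_univ_castSucc]
        simp only [Fin.lastCases_last, Fin.lastCases_castSucc]
        rw [← Finset.sum_div, ← add_div, add_comm, div_self hS.ne'])
    refine ⟨μ, hμ, ?_⟩
    ext i
    have h1 := tt_sq ha hμ i
    rw [hw, hw] at h1
    simp only [Fin.lastCases_last, Fin.lastCases_castSucc] at h1
    have h2 : tt a μ i ^ 2 = t i ^ 2 := by rw [h1]; field_simp
    exact (pow_left_inj₀ (tt_pos a μ i).le (ht' i).le two_ne_zero).mp h2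

lemma slab_eq_pi {m : ℕ} (a : Fin (m + 1) → ℝ) :
    slab a = Set.univ.pi fun i : Fin m => Set.Ioo (a i.succ) (a i.castSucc) := by
  ext μ; simp [slab, Set.mem_pi]

lemma measurableSet_slab {m : ℕ} (a : Fin (m + 1) → ℝ) : MeasurableSet (slab a) := by
  rw [slab_eq_pi]
  exact MeasurableSet.univ_pi fun i => measurableSet_Ioo

lemma change_var {m : ℕ} {a : Fin (m + 1) → ℝ} (ha : StrictAnti a)
    (G : (Fin m → ℝ) → ℝ≥0∞) :
    ∫⁻ t in Set.univ.pi fun _ => Set.Ioi (0 : ℝ), G t =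
      ∫⁻ μ in slab a, ENNReal.ofReal |(DM a μ).det| * G (tt a μ) := by
  rw [← tt_image ha, lintegral_image_eq_lintegral_abs_det_fderiv_mul volume (measurableSet_slab a)
    (fun μ hμ => (tt_deriv ha hμ).hasFDerivWithinAt) (tt_injOn ha)]
  refine lintegral_congr fun μ => ?_
  congr 3
  exact LinearMap.det_toLin' _

/-! ### The recursion for the orthogonal integral -/

lemma sum_snoc_sq {m : ℕ} (t : Fin m → ℝ) (r : ℝ) :
    ∑ j, (Fin.snoc (α := fun _ => ℝ) t r : Fin (m + 1) → ℝ) j ^ 2 = r ^ 2 + ∑ i, t i ^ 2 := by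
  rw [Fin.sum_univ_castSucc]
  simp [add_comm]

lemma recursion {m : ℕ} (s : Fin (m + 1) → ℝ) {a : Fin (m + 1) → ℝ} (ha : StrictAnti a)
    {κ : Measure (Matrix (Fin m) (Fin m) ℝ)} (hκ : IsHaarOrth m κ)
    {ν : Measure (Matrix (Fin (m + 1)) (Fin (m + 1)) ℝ)} (hν : IsHaarOrth (m + 1) ν) :
    ∫⁻ V, qf s a V ∂ν =
      ENNReal.ofReal (Real.Gamma (((m : ℝ) + 1) / 2) / Real.Gamma (1 / 2) ^ (m + 1)) *
      ∫⁻ μ in slab a, ENNReal.ofReal (VV μ / √(∏ i, ∏ j, |a i - μ j|)) *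
        (ENNReal.ofReal (Real.exp (s (Fin.last m) * (∑ i, a i - ∑ j, μ j))) *
        ∫⁻ W, qf (fun l => s l.castSucc) μ W ∂κ) := by
  have := hκ.1
  have hG : 0 < Real.Gamma (1 / 2) ^ (m + 1) := pow_pos (Real.Gamma_pos_of_pos (by norm_num)) _
  have h1 := gauss_lemma s a hκ hν
  have hpos : ∀ t : Fin m → ℝ,
      0 < ∑ j, (Fin.snoc (α := fun _ => ℝ) t 1 : Fin (m + 1) → ℝ) j ^ 2 := by
    intro t; rw [sum_snoc_sq]; positivity
  have hsm : Measurable fun t : Fin m → ℝ => (Fin.snoc (α := fun _ => ℝ) t 1 : Fin (m + 1) → ℝ) := by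
    refine measurable_pi_lambda _ fun i => ?_
    induction i using Fin.lastCases with
    | last => simp
    | cast i => simpa using measurable_pi_apply i
  rw [lint_gauss, proj_coords (Phi s a κ) (measurable_Phi s a κ), lint_abs,
    change_var ha] at h1
  · have h2 : 2 ^ m * ∫⁻ μ in slab a, ENNReal.ofReal |(DM a μ).det| *
        (Phi s a κ (Fin.snoc (α := fun _ => ℝ) (tt a μ) 1) *
          ENNReal.ofReal ((1 + ∑ i, tt a μ i ^ 2) ^ (-((m : ℝ) + 1) / 2))) =
        ∫⁻ μ in slab a, ENNReal.ofReal (VV μ / √(∏ i, ∏ j, |a i - μ j|)) *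
        (ENNReal.ofReal (Real.exp (s (Fin.last m) * (∑ i, a i - ∑ j, μ j))) *
        ∫⁻ W, qf (fun l => s l.castSucc) μ W ∂κ) := by
      rw [← lintegral_const_mul' _ _ (by simp)]
      refine setLIntegral_congr_fun (measurableSet_slab a) fun μ hμ => ?_
      have hw := ww_pos ha hμ (Fin.last m)
      rw [Phi_slab s ha hμ hκ _ (hpos _), ← dens_eq ha hμ, ENNReal.ofReal_mul (by positivity),
        ENNReal.ofReal_mul (by positivity), ENNReal.ofReal_pow (by norm_num)]
      · simp only [ENNReal.ofReal_ofNat]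
        ring
      · intro i
        rw [sum_snoc_sq, one_pow, one_add_tt ha hμ]
        induction i using Fin.lastCases with
        | last => simp [hw.ne']
        | cast i => simp [tt_sq ha hμ, div_eq_mul_inv]
    rw [h2] at h1
    rw [ENNReal.ofReal_div_of_pos hG, div_eq_mul_inv, mul_right_comm, h1, mul_assoc,
      ENNReal.mul_inv_cancel, mul_one]
    · simpa using hG
    · simp
  · refine ((measurable_Phi s a κ).comp hsm).mul ?_
    fun_prop
  · intro t
    congr 1
    · refine Phi_congr s a hκ _ _ (hpos _) 1 one_pos ?_
      intro i
      induction i using Fin.lastCases with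
      | last => simp
      | cast i => simp
    · simp
  · intro t r hr
    refine Phi_congr s a hκ _ _ (hpos _) (r ^ 2) (by positivity) ?_
    intro i
    induction i using Fin.lastCases with
    | last => simp
    | cast i => simp [mul_pow]

/-! ### The Gelfand-Tsetlin side -/

/-- interaction factor between two levels -/
def fac (l : ℕ) (x y : ℕ → ℝ) : ℝ :=
  cross l (l + 1) x y ^ ((1 : ℝ) / 2 - 1) /
    (vand l x ^ ((1 : ℝ) / 2 - 1) * vand (l + 1) y ^ ((1 : ℝ) / 2 - 1))

/-- integrand over patterns -/
def gg (m : ℕ) (s lam : ℕ → ℝ) (μ : Arr (m - 1) m) : ℝ :=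
  Real.exp (∑ l ∈ range m, s l * (asum (l + 1) (levT μ lam (l + 1)) - asum l (levT μ lam l))) *
    ∏ l ∈ Ico 1 m, fac l (levT μ lam l) (levT μ lam (l + 1))

/-- the pattern integral -/
def JJ (m : ℕ) (s lam : ℕ → ℝ) : ℝ≥0∞ :=
  ∫⁻ μ in GTset m m lam, ENNReal.ofReal (gg m s lam μ)

lemma mem_coords (k n l i : ℕ) : (l, i) ∈ coords k n ↔ l < k ∧ i < n ∧ i < l + 1 := by
  simp [coords]; omega

lemma mem_sp1 {m : ℕ} (p : { p // p ∈ coords (m - 1) m }) : p.1 ∈ coords m (m + 1) := by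
  obtain ⟨⟨l, i⟩, hp⟩ := p
  rw [mem_coords] at hp ⊢
  omega

lemma mem_sp2 {m : ℕ} (i : Fin m) : (m - 1, (i : ℕ)) ∈ coords m (m + 1) := by
  rw [mem_coords]
  have := i.2; omega

/-- split off the top level -/
def sp (m : ℕ) (μ : Arr m (m + 1)) : Arr (m - 1) m × (Fin m → ℝ) :=
  (fun p => μ ⟨p.1, mem_sp1 p⟩, fun i => μ ⟨(m - 1, i), mem_sp2 i⟩)

/-- index equivalence -/
def spE (m : ℕ) : { p // p ∈ coords m (m + 1) } ≃ { p // p ∈ coords (m - 1) m } ⊕ Fin m where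
  toFun p := if h : p.1.1 < m - 1 then
      Sum.inl ⟨p.1, by
        obtain ⟨⟨l, i⟩, hp⟩ := p
        rw [mem_coords] at hp ⊢
        simp only at h
        omega⟩
    else Sum.inr ⟨p.1.2, by
        obtain ⟨⟨l, i⟩, hp⟩ := p
        rw [mem_coords] at hp
        simp only at h ⊢
        omega⟩
  invFun q := Sum.elim
    (fun p : { p // p ∈ coords (m - 1) m } => (⟨p.1, mem_sp1 p⟩ : { p // p ∈ coords m (m + 1) }))
    (fun i : Fin m => ⟨(m - 1, (i : ℕ)), mem_sp2 i⟩) q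
  left_inv := by
    rintro ⟨⟨l, i⟩, hp⟩
    rw [mem_coords] at hp
    by_cases h : l < m - 1
    · simp [h]
    · simp only [h, dite_false, Sum.elim_inr, Subtype.mk.injEq, Prod.mk.injEq, and_true]
      omega
  right_inv := by
    rintro (⟨⟨l, i⟩, hp⟩ | i)
    · rw [mem_coords] at hp
      simp [hp.1]
    · simp

lemma mp_gen {ι ι' : Type} [Fintype ι] [Fintype ι'] :
    MeasurePreserving (fun f : ι ⊕ ι' → ℝ => ((fun i => f (Sum.inl i), fun i => f (Sum.inr i)) :
      (ι → ℝ) × (ι' → ℝ))) volume volume :=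
  volume_measurePreserving_sumPiEquivProdPi (fun _ : ι ⊕ ι' => ℝ)

lemma mp_gen2 {ι ι' : Type} [Fintype ι] [Fintype ι'] (e : ι ≃ ι') :
    MeasurePreserving (fun f : ι → ℝ => ((fun i => f (e.symm i)) : ι' → ℝ)) volume volume :=
  volume_preserving_arrowCongr' e (MeasurableEquiv.refl ℝ) (MeasurePreserving.id volume)

lemma mp_sp (m : ℕ) : MeasurePreserving (sp m) volume volume :=
  (mp_gen (ι := ↥(coords (m - 1) m)) (ι' := Fin m)).comp (mp_gen2 (spE m))

lemma levT_top {m n : ℕ} (hm : m ≠ 0) (μ : Arr (m - 1) n) (lam : ℕ → ℝ) : levT μ lam m = lam := by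
  ext i; simp [levT, hm]

lemma levT_sp (m : ℕ) (μ : Arr m (m + 1)) (lam : ℕ → ℝ) (l : ℕ) (hl : l ≤ m) :
    levT (m := m + 1) (n := m + 1) μ lam l = levT (m := m) (n := m) (sp m μ).1 (extF (sp m μ).2) l := by
  ext i
  unfold levT
  by_cases h0 : l = 0
  · simp [h0]
  · rw [if_neg h0, if_neg h0, if_neg (by omega)]
    unfold ent
    by_cases h1 : l = m
    · rw [if_pos h1]
      unfold extF
      by_cases h2 : i < m
      · rw [dif_pos h2, dif_pos (by rw [mem_coords]; omega)]
        simp only [sp]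
        congr 3
        omega
      · rw [dif_neg h2, dif_neg (by rw [mem_coords]; omega)]
    · rw [if_neg h1]
      by_cases h2 : i < l
      · rw [dif_pos (by rw [mem_coords]; omega), dif_pos (by rw [mem_coords]; omega)]
        rfl
      · rw [dif_neg (by rw [mem_coords]; omega), dif_neg (by rw [mem_coords]; omega)]

lemma GT_sp (m : ℕ) (μ : Arr m (m + 1)) (lam : ℕ → ℝ) :
    μ ∈ GTset (m + 1) (m + 1) lam ↔
      interlaces m (m + 1) (extF (sp m μ).2) lam ∧ (sp m μ).1 ∈ GTset m m (extF (sp m μ).2) := by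
  have htop : levT (m := m + 1) (n := m + 1) μ lam (m + 1) = lam := levT_top (by omega) _ _
  constructor
  · intro h
    constructor
    · rcases Nat.eq_zero_or_pos m with h0 | h0
      · subst h0; constructor <;> intro i hi <;> omega
      · have := h m h0 (by omega)
        rw [levT_sp m μ lam m le_rfl, levT_top (by omega), htop] at this
        simpa using this
    · intro l h1 h2
      have := h l h1 (by omega)
      rw [levT_sp m μ lam l (by omega), levT_sp m μ lam (l + 1) (by omega)] at this
      rw [min_eq_left (by omega), min_eq_left (by omega)] at this ⊢
      exact this
  · rintro ⟨h1, h2⟩ l hl hl'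
    rcases Nat.lt_or_ge l m with h3 | h3
    · have := h2 l hl h3
      rw [levT_sp m μ lam l (by omega), levT_sp m μ lam (l + 1) (by omega)]
      rw [min_eq_left (by omega), min_eq_left (by omega)] at this ⊢
      exact this
    · have : l = m := by omega
      subst this
      rw [levT_sp l μ lam l le_rfl, levT_top (by omega), htop]
      simpa using h1

/-- one-step kernel -/
def ker (m : ℕ) (s lam x : ℕ → ℝ) : ℝ :=
  Real.exp (s m * (asum (m + 1) lam - asum m x)) * fac m x lam

lemma fac_zero (x y : ℕ → ℝ) : fac 0 x y = 1 := by
  simp [fac, cross, vand]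

lemma gg_sp (m : ℕ) (s lam : ℕ → ℝ) (μ : Arr m (m + 1)) :
    gg (m + 1) s lam μ = ker m s lam (extF (sp m μ).2) * gg m s (extF (sp m μ).2) (sp m μ).1 := by
  have htop : levT (m := m + 1) (n := m + 1) μ lam (m + 1) = lam := levT_top (by omega) _ _
  have h1 : ∑ l ∈ range (m + 1), s l * (asum (l + 1) (levT (m := m + 1) (n := m + 1) μ lam (l + 1)) -
      asum l (levT (m := m + 1) (n := m + 1) μ lam l)) =
      (∑ l ∈ range m, s l * (asum (l + 1) (levT (sp m μ).1 (extF (sp m μ).2) (l + 1)) -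
        asum l (levT (sp m μ).1 (extF (sp m μ).2) l))) +
        s m * (asum (m + 1) lam - asum m (extF (sp m μ).2)) := by
    rw [Finset.sum_range_succ, htop]
    congr 1
    · refine Finset.sum_congr rfl fun l hl => ?_
      have := Finset.mem_range.mp hl
      rw [levT_sp m μ lam l (by omega), levT_sp m μ lam (l + 1) (by omega)]
    · rcases Nat.eq_zero_or_pos m with h0 | h0
      · subst h0; simp [asum]
      · rw [levT_sp m μ lam m le_rfl, levT_top (by omega)]
  have h2 : ∏ l ∈ Ico 1 (m + 1), fac l (levT (m := m + 1) (n := m + 1) μ lam l)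
        (levT (m := m + 1) (n := m + 1) μ lam (l + 1)) =
      (∏ l ∈ Ico 1 m, fac l (levT (sp m μ).1 (extF (sp m μ).2) l)
        (levT (sp m μ).1 (extF (sp m μ).2) (l + 1))) * fac m (extF (sp m μ).2) lam := by
    rcases Nat.eq_zero_or_pos m with h0 | h0
    · subst h0; simp [fac_zero]
    · rw [Finset.prod_Ico_succ_top (by omega), htop, levT_sp m μ lam m le_rfl, levT_top (by omega)]
      congr 1
      refine Finset.prod_congr rfl fun l hl => ?_
      have := Finset.mem_Ico.mp hl
      rw [levT_sp m μ lam l (by omega), levT_sp m μ lam (l + 1) (by omega)]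
  unfold gg ker
  rw [h1, h2, Real.exp_add]
  ring

/-! measurability -/

lemma measurable_vand {X : Type*} [MeasurableSpace X] (k : ℕ) (x : X → ℕ → ℝ)
    (hx : ∀ i, Measurable fun p => x p i) : Measurable fun p => vand k (x p) := by
  unfold vand
  refine Finset.measurable_prod _ fun i _ => Finset.measurable_prod _ fun j _ => ?_
  split_ifs
  · exact (hx i).sub (hx j)
  · exact measurable_const

lemma measurable_cross {X : Type*} [MeasurableSpace X] (k l : ℕ) (x y : X → ℕ → ℝ)
    (hx : ∀ i, Measurable fun p => x p i) (hy : ∀ i, Measurable fun p => y p i) :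
    Measurable fun p => cross k l (x p) (y p) := by
  unfold cross
  refine Finset.measurable_prod _ fun i _ => Finset.measurable_prod _ fun j _ => ?_
  exact ((hx i).sub (hy j)).abs

lemma measurable_asum {X : Type*} [MeasurableSpace X] (k : ℕ) (x : X → ℕ → ℝ)
    (hx : ∀ i, Measurable fun p => x p i) : Measurable fun p => asum k (x p) := by
  unfold asum
  exact Finset.measurable_sum _ fun i _ => hx i

lemma measurable_fac {X : Type*} [MeasurableSpace X] (l : ℕ) (x y : X → ℕ → ℝ)
    (hx : ∀ i, Measurable fun p => x p i) (hy : ∀ i, Measurable fun p => y p i) :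
    Measurable fun p => fac l (x p) (y p) := by
  unfold fac
  exact ((measurable_cross _ _ x y hx hy).pow_const _).div
    (((measurable_vand _ x hx).pow_const _).mul ((measurable_vand _ y hy).pow_const _))

lemma measurableSet_interlaces {X : Type*} [MeasurableSpace X] (k l : ℕ) (x y : X → ℕ → ℝ)
    (hx : ∀ i, Measurable fun p => x p i) (hy : ∀ i, Measurable fun p => y p i) :
    MeasurableSet {p | interlaces k l (x p) (y p)} := by
  unfold interlaces
  refine MeasurableSet.inter (s₁ := {p | ∀ i, i < k → x p i ≤ y p i})
    (s₂ := {p | ∀ i, i < k → i + 1 < l → y p (i + 1) ≤ x p i}) ?_ ?_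
  · simp only [Set.setOf_forall]
    exact MeasurableSet.iInter fun i => MeasurableSet.iInter fun _ =>
      measurableSet_le (hx i) (hy i)
  · simp only [Set.setOf_forall]
    exact MeasurableSet.iInter fun i => MeasurableSet.iInter fun _ => MeasurableSet.iInter fun _ =>
      measurableSet_le (hy (i + 1)) (hx i)

lemma measurable_levT {X : Type*} [MeasurableSpace X] {m n : ℕ} (μ : X → Arr (m - 1) n)
    (lam : X → ℕ → ℝ) (hμ : Measurable μ) (hl : ∀ i, Measurable fun p => lam p i) (l i : ℕ) :
    Measurable fun p => levT (m := m) (μ p) (lam p) l i := by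
  unfold levT
  split_ifs
  · exact measurable_const
  · exact hl i
  · unfold ent
    split_ifs
    · exact (measurable_pi_apply _).comp hμ
    · exact measurable_const

lemma measurable_gg {X : Type*} [MeasurableSpace X] {m : ℕ} (s : ℕ → ℝ) (μ : X → Arr (m - 1) m)
    (lam : X → ℕ → ℝ) (hμ : Measurable μ) (hl : ∀ i, Measurable fun p => lam p i) :
    Measurable fun p => gg m s (lam p) (μ p) := by
  unfold gg
  have h := measurable_levT μ lam hμ hl
  refine Measurable.mul (Real.measurable_exp.comp (Finset.measurable_sum _ fun l _ => ?_))
    (Finset.measurable_prod _ fun l _ => measurable_fac _ _ _ (h _) (h _))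
  exact ((measurable_asum _ _ (h _)).sub (measurable_asum _ _ (h _))).const_mul _

lemma measurableSet_GT {X : Type*} [MeasurableSpace X] {m n : ℕ} (μ : X → Arr (m - 1) n)
    (lam : X → ℕ → ℝ) (hμ : Measurable μ) (hl : ∀ i, Measurable fun p => lam p i) :
    MeasurableSet {p | μ p ∈ GTset m n (lam p)} := by
  unfold GTset
  have h := measurable_levT μ lam hμ hl
  change MeasurableSet {p | ∀ l, 1 ≤ l → l < m →
    interlaces (min l n) (min (l + 1) n) (levT (μ p) (lam p) l) (levT (μ p) (lam p) (l + 1))}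
  simp only [Set.setOf_forall]
  refine MeasurableSet.iInter fun l => ?_
  refine MeasurableSet.iInter fun _ => ?_
  refine MeasurableSet.iInter fun _ => ?_
  exact measurableSet_interlaces _ _ _ _ (h _) (h _)

lemma measurable_extF {X : Type*} [MeasurableSpace X] {m : ℕ} (ν : X → Fin m → ℝ)
    (hν : Measurable ν) (i : ℕ) : Measurable fun p => extF (ν p) i := by
  unfold extF
  split_ifs
  · exact (measurable_pi_apply _).comp hν
  · exact measurable_const

lemma JJ_succ (m : ℕ) (s lam : ℕ → ℝ)
    (hker : ∀ ν : Fin m → ℝ, interlaces m (m + 1) (extF ν) lam → 0 ≤ ker m s lam (extF ν)) :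
    JJ (m + 1) s lam = ∫⁻ ν in {ν : Fin m → ℝ | interlaces m (m + 1) (extF ν) lam},
      ENNReal.ofReal (ker m s lam (extF ν)) * JJ m s (extF ν) := by
  let A : Set (Fin m → ℝ) := {ν | interlaces m (m + 1) (extF ν) lam}
  let k1 : (Fin m → ℝ) → ℝ≥0∞ := A.indicator fun ν => ENNReal.ofReal (ker m s lam (extF ν))
  let B : Set (Arr (m - 1) m × (Fin m → ℝ)) := {p | p.1 ∈ GTset m m (extF p.2)}
  let k2 : Arr (m - 1) m × (Fin m → ℝ) → ℝ≥0∞ :=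
    B.indicator fun p => ENNReal.ofReal (gg m s (extF p.2) p.1)
  have hext : ∀ i, Measurable fun ν : Fin m → ℝ => extF ν i := measurable_extF _ measurable_id
  have hext2 : ∀ i, Measurable fun p : Arr (m - 1) m × (Fin m → ℝ) => extF p.2 i :=
    measurable_extF _ measurable_snd
  have hA : MeasurableSet A :=
    measurableSet_interlaces _ _ _ _ hext (fun _ => measurable_const)
  have hB : MeasurableSet B := measurableSet_GT _ _ measurable_fst hext2
  have hk1 : Measurable k1 := by
    refine Measurable.indicator ?_ hA
    refine ENNReal.measurable_ofReal.comp ?_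
    unfold ker
    exact (Real.measurable_exp.comp ((measurable_const.sub (measurable_asum _ _ hext)).const_mul _)).mul
      (measurable_fac _ _ _ hext (fun _ => measurable_const))
  have hk2 : Measurable k2 :=
    Measurable.indicator (ENNReal.measurable_ofReal.comp
      (measurable_gg s _ _ measurable_fst hext2)) hB
  have hF : Measurable fun p : Arr (m - 1) m × (Fin m → ℝ) => k1 p.2 * k2 p :=
    (hk1.comp measurable_snd).mul hk2
  have hGT : MeasurableSet (GTset (m + 1) (m + 1) lam) :=
    measurableSet_GT (fun μ => μ) (fun _ => lam) measurable_id (fun _ => measurable_const)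
  have h1 : JJ (m + 1) s lam = ∫⁻ μ, k1 (sp m μ).2 * k2 (sp m μ) := by
    unfold JJ
    rw [← lintegral_indicator hGT]
    refine lintegral_congr fun μ => ?_
    by_cases hμ : μ ∈ GTset (m + 1) (m + 1) lam
    · obtain ⟨ha, hb⟩ := (GT_sp m μ lam).mp hμ
      rw [Set.indicator_of_mem hμ]
      simp only [k1, k2]
      rw [Set.indicator_of_mem (show (sp m μ).2 ∈ A from ha),
        Set.indicator_of_mem (show sp m μ ∈ B from hb), gg_sp, ENNReal.ofReal_mul (hker _ ha)]
    · rw [Set.indicator_of_notMem hμ]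
      simp only [k1, k2]
      by_cases ha : (sp m μ).2 ∈ A
      · have hb : sp m μ ∉ B := fun hb => hμ ((GT_sp m μ lam).mpr ⟨ha, hb⟩)
        rw [Set.indicator_of_notMem hb, mul_zero]
      · rw [Set.indicator_of_notMem ha, zero_mul]
  rw [h1, (mp_sp m).lintegral_comp hF]
  change ∫⁻ p, k1 p.2 * k2 p ∂(Measure.prod volume volume) = _
  rw [lintegral_prod_symm' _ hF, ← lintegral_indicator hA]
  refine lintegral_congr fun ν => ?_
  have hk2' : Measurable fun x => k2 (x, ν) := hk2.comp (measurable_id.prodMk measurable_const)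
  change ∫⁻ x, k1 ν * k2 (x, ν) = _
  rw [lintegral_const_mul _ hk2']
  have hJ : ∫⁻ x, k2 (x, ν) = JJ m s (extF ν) := by
    unfold JJ
    have hG : MeasurableSet (GTset m m (extF ν)) := measurableSet_GT (fun μ => μ) (fun _ => extF ν)
      measurable_id (fun _ => measurable_const)
    rw [← lintegral_indicator hG]
    rfl
  rw [hJ]
  by_cases hν : ν ∈ A
  · simp only [k1]
    rw [Set.indicator_of_mem hν, Set.indicator_of_mem hν]
  · simp only [k1]
    rw [Set.indicator_of_notMem hν, Set.indicator_of_notMem hν, zero_mul]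

/-! ### Induction -/

lemma vand_nonneg {k : ℕ} {x : ℕ → ℝ} (hx : ∀ i j, i < j → j < k → x j ≤ x i) : 0 ≤ vand k x := by
  unfold vand
  refine Finset.prod_nonneg fun i hi => Finset.prod_nonneg fun j hj => ?_
  split_ifs with h
  · have := hx i j h (Finset.mem_range.mp hj); linarith
  · exact zero_le_one

lemma vand_pos {k : ℕ} {x : ℕ → ℝ} (hx : ∀ i j, i < j → j < k → x j < x i) : 0 < vand k x := by
  unfold vand
  refine Finset.prod_pos fun i hi => Finset.prod_pos fun j hj => ?_
  split_ifs with h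
  · have := hx i j h (Finset.mem_range.mp hj); linarith
  · exact zero_lt_one

lemma cross_nonneg (k l : ℕ) (x y : ℕ → ℝ) : 0 ≤ cross k l x y :=
  Finset.prod_nonneg fun i _ => Finset.prod_nonneg fun j _ => abs_nonneg _

lemma fac_nonneg {l : ℕ} {x y : ℕ → ℝ} (hx : ∀ i j, i < j → j < l → x j ≤ x i)
    (hy : ∀ i j, i < j → j < l + 1 → y j ≤ y i) : 0 ≤ fac l x y := by
  unfold fac
  have h1 := cross_nonneg l (l + 1) x y
  have h2 := vand_nonneg hx
  have h3 := vand_nonneg hy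
  positivity

lemma interlaces_decr {k : ℕ} {x y : ℕ → ℝ} (hy : ∀ i j, i < j → j < k + 1 → y j ≤ y i)
    (h : interlaces k (k + 1) x y) : ∀ i j, i < j → j < k → x j ≤ x i := by
  intro i j hij hj
  have h1 := h.1 j hj
  have h2 := h.2 i (by omega) (by omega)
  rcases Nat.lt_or_ge (i + 1) j with h3 | h3
  · have := hy (i + 1) j h3 (by omega); linarith
  · have : j = i + 1 := by omega
    subst this; linarith

lemma ker_nonneg {k : ℕ} {s x y : ℕ → ℝ} (hy : ∀ i j, i < j → j < k + 1 → y j ≤ y i)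
    (h : interlaces k (k + 1) x y) : 0 ≤ ker k s y x :=
  mul_nonneg (Real.exp_pos _).le (fac_nonneg (interlaces_decr hy h) hy)

lemma extF_val {k : ℕ} (x : Fin k → ℝ) (i : Fin k) : extF x i = x i := by
  simp [extF]

lemma asum_fin (k : ℕ) (x : ℕ → ℝ) : asum k x = ∑ i : Fin k, x i := by
  unfold asum; rw [Finset.sum_range]

lemma asum_extF {k : ℕ} (x : Fin k → ℝ) : asum k (extF x) = ∑ i, x i := by
  rw [asum_fin]; simp only [extF_val]

lemma cross_extF {k l : ℕ} (x : Fin k → ℝ) (y : ℕ → ℝ) :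
    cross k l (extF x) y = ∏ i : Fin l, ∏ j : Fin k, |y i - x j| := by
  unfold cross
  rw [Finset.prod_comm, Finset.prod_range]
  refine Finset.prod_congr rfl fun i _ => ?_
  rw [Finset.prod_range]
  refine Finset.prod_congr rfl fun j _ => ?_
  rw [extF_val, abs_sub_comm]

lemma vand_extF {k : ℕ} {x : Fin k → ℝ} (hx : StrictAnti x) : vand k (extF x) = VV x := by
  unfold vand VV
  rw [Finset.prod_range]
  refine Finset.prod_congr rfl fun i _ => ?_
  rw [Finset.prod_range]
  have : Finset.Ioi i = Finset.univ.filter fun j => i < j := by ext j; simp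
  rw [this, Finset.prod_filter]
  refine Finset.prod_congr rfl fun j _ => ?_
  rw [extF_val, extF_val]
  simp only [Fin.val_fin_lt]
  split_ifs with h
  · rw [abs_of_neg (by have := hx h; linarith)]; ring
  · rfl

lemma slab_ae {m : ℕ} (lam : ℕ → ℝ) :
    slab (fun i : Fin (m + 1) => lam i) =ᵐ[volume]
      {ν : Fin m → ℝ | interlaces m (m + 1) (extF ν) lam} := by
  have : {ν : Fin m → ℝ | interlaces m (m + 1) (extF ν) lam} =
      Set.Icc (fun i : Fin m => lam (i + 1)) (fun i : Fin m => lam i) := by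
    ext ν
    simp only [Set.mem_setOf_eq, Set.mem_Icc, Pi.le_def, interlaces]
    constructor
    · rintro ⟨h1, h2⟩
      refine ⟨fun i => ?_, fun i => ?_⟩
      · have := h2 i i.2 (by omega); rwa [extF_val] at this
      · have := h1 i i.2; rwa [extF_val] at this
    · rintro ⟨h1, h2⟩
      refine ⟨fun i hi => ?_, fun i hi _ => ?_⟩
      · have := h2 ⟨i, hi⟩; rwa [← extF_val ν] at this
      · have := h1 ⟨i, hi⟩; rwa [← extF_val ν] at this
  rw [this, slab_eq_pi]
  exact Measure.univ_pi_Ioo_ae_eq_Icc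

/-- normalising constant -/
def KK (m : ℕ) : ℝ := ∏ k ∈ range m, Real.Gamma (((k : ℝ) + 1) / 2) / Real.Gamma (1 / 2) ^ (k + 1)

lemma cc_pos (k : ℕ) : 0 < Real.Gamma (((k : ℝ) + 1) / 2) / Real.Gamma (1 / 2) ^ (k + 1) := by
  have h1 : 0 < Real.Gamma (((k : ℝ) + 1) / 2) := Real.Gamma_pos_of_pos (by positivity)
  have h2 : 0 < Real.Gamma (1 / 2 : ℝ) := Real.Gamma_pos_of_pos (by norm_num)
  positivity

lemma KK_pos (m : ℕ) : 0 < KK m := Finset.prod_pos fun k _ => cc_pos k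

lemma JJ_zero (s lam : ℕ → ℝ) : JJ 0 s lam = 1 := by
  have hE : IsEmpty { p // p ∈ coords (0 - 1) 0 } := by
    refine ⟨?_⟩
    rintro ⟨⟨l, i⟩, hp⟩
    rw [mem_coords] at hp; omega
  have h1 : GTset 0 0 lam = Set.univ := by
    ext μ; simp [GTset]
  unfold JJ
  rw [h1, Measure.restrict_univ]
  have : ∀ μ, gg 0 s lam μ = 1 := by intro μ; simp [gg]
  simp only [this, ENNReal.ofReal_one, lintegral_one]
  rw [volume_pi, Measure.pi_of_empty]
  simp

lemma alg_step {v X K w : ℝ} (hv : 0 < v) (hX : 0 < X) (hw : 0 < w) :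
    v / √X * (K / v ^ ((1 : ℝ) / 2)) =
      K / w ^ ((1 : ℝ) / 2) * (X ^ ((1 : ℝ) / 2 - 1) /
        (v ^ ((1 : ℝ) / 2 - 1) * w ^ ((1 : ℝ) / 2 - 1))) := by
  have h : ((1 : ℝ) / 2 - 1) = -(1 / 2) := by norm_num
  rw [h, Real.rpow_neg hv.le, Real.rpow_neg hX.le, Real.rpow_neg hw.le, ← Real.sqrt_eq_rpow,
    ← Real.sqrt_eq_rpow, ← Real.sqrt_eq_rpow]
  have h1 := Real.sqrt_pos.mpr hv
  have h2 := Real.sqrt_pos.mpr hX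
  have h3 := Real.sqrt_pos.mpr hw
  have h4 := Real.sq_sqrt hv.le
  field_simp
  rw [h4]
  ring

lemma claim (m : ℕ) : ∀ (lam s : ℕ → ℝ), (∀ i j, i < j → j < m → lam j < lam i) →
    ∀ ν : Measure (Matrix (Fin m) (Fin m) ℝ), IsHaarOrth m ν →
    ∫⁻ V, qf (fun l : Fin m => s l) (fun i : Fin m => lam i) V ∂ν =
      ENNReal.ofReal (KK m / vand m lam ^ ((1 : ℝ) / 2)) * JJ m s lam := by
  induction m with
  | zero =>
    intro lam s _ ν hν
    have := hν.1
    rw [JJ_zero]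
    simp [qf, KK, vand]
  | succ m ih =>
    intro lam s hlam ν hν
    obtain ⟨κ, hκ⟩ := haar_exists m
    have ha : StrictAnti (fun i : Fin (m + 1) => lam i) := fun i j hij =>
      hlam i j hij j.2
    have hw : 0 < vand (m + 1) lam := vand_pos hlam
    have hw2 : 0 < vand (m + 1) lam ^ ((1 : ℝ) / 2) := Real.rpow_pos_of_pos hw _
    have hdec : ∀ i j, i < j → j < m + 1 → lam j ≤ lam i := fun i j h1 h2 => (hlam i j h1 h2).le
    rw [recursion (fun l : Fin (m + 1) => s l) ha hκ hν]
    rw [JJ_succ m s lam (fun ν h => ker_nonneg hdec h)]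
    rw [setLIntegral_congr (slab_ae lam).symm]
    have hK : KK (m + 1) = Real.Gamma (((m : ℝ) + 1) / 2) / Real.Gamma (1 / 2) ^ (m + 1) * KK m := by
      unfold KK; rw [Finset.prod_range_succ, mul_comm]
    rw [hK, mul_div_assoc, ENNReal.ofReal_mul (cc_pos m).le, mul_assoc]
    congr 1
    rw [← lintegral_const_mul' _ _ ENNReal.ofReal_ne_top]
    refine setLIntegral_congr_fun (measurableSet_slab _) fun μ hμ => ?_
    have hμa : StrictAnti μ := slab_strictAnti ha hμ
    have hih := ih (extF μ) s (fun i j hij hj => by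
      have := hμa (show (⟨i, by omega⟩ : Fin m) < ⟨j, hj⟩ from hij)
      rw [← extF_val μ, ← extF_val μ] at this
      exact this) κ hκ
    simp only [extF_val] at hih
    have hih' : ∫⁻ W, qf (fun l : Fin m => s l.castSucc) μ W ∂κ =
      ENNReal.ofReal (KK m / vand m (extF μ) ^ ((1 : ℝ) / 2)) * JJ m s (extF μ) := hih
    have hv : 0 < VV μ := VV_pos hμa.injective
    have hX : 0 < ∏ i : Fin (m + 1), ∏ j : Fin m, |lam i - μ j| :=
      Finset.prod_pos fun i _ => Finset.prod_pos fun j _ => abs_pos.mpr (slab_ne ha hμ i j)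
    beta_reduce
    simp only [Fin.val_castSucc] at hih' ⊢
    rw [hih', ← mul_assoc, ← mul_assoc, ← mul_assoc]
    congr 1
    have hKm := KK_pos m
    have hv2 : 0 < VV μ ^ ((1 : ℝ) / 2) := Real.rpow_pos_of_pos hv _
    rw [vand_extF hμa, ← ENNReal.ofReal_mul (by positivity), ← ENNReal.ofReal_mul (by positivity),
      ← ENNReal.ofReal_mul (by positivity)]
    congr 1
    unfold ker fac
    rw [vand_extF hμa, cross_extF, asum_extF, asum_fin]
    have := alg_step (K := KK m) hv hX hw
    simp only [Fin.val_last]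
    calc _ = Real.exp (s m * (∑ i : Fin (m + 1), lam i - ∑ j, μ j)) * (VV μ / √(∏ i : Fin (m + 1), ∏ j : Fin m, |lam i - μ j|) * (KK m / VV μ ^ ((1 : ℝ) / 2))) := by ring
      _ = _ := by rw [this]; ring

/-! ### Conclusion -/

lemma level_decr {m : ℕ} {lam : ℕ → ℝ} (hlam : ∀ i j, i < j → j < m → lam j ≤ lam i)
    {μ : Arr (m - 1) m} (hμ : μ ∈ GTset m m lam) (d : ℕ) :
    ∀ l, 1 ≤ l → l + d = m → ∀ i j, i < j → j < l → levT μ lam l j ≤ levT μ lam l i := by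
  induction d with
  | zero =>
    intro l hl hd
    have : l = m := by omega
    subst this
    rw [levT_top (by omega)]
    exact hlam
  | succ d ih =>
    intro l hl hd
    have h1 := ih (l + 1) (by omega) (by omega)
    have h2 := hμ l hl (by omega)
    rw [min_eq_left (by omega), min_eq_left (by omega)] at h2
    exact interlaces_decr h1 h2

lemma gg_nonneg {m : ℕ} {s lam : ℕ → ℝ} (hlam : ∀ i j, i < j → j < m → lam j ≤ lam i)
    {μ : Arr (m - 1) m} (hμ : μ ∈ GTset m m lam) : 0 ≤ gg m s lam μ := by
  refine mul_nonneg (Real.exp_pos _).le (Finset.prod_nonneg fun l hl => ?_)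
  have := Finset.mem_Ico.mp hl
  exact fac_nonneg (level_decr hlam hμ (m - l) l (by omega) (by omega))
    (level_decr hlam hμ (m - (l + 1)) (l + 1) (by omega) (by omega))

lemma Icc_one_eq (m : ℕ) : Icc 1 m = Ico 1 (m + 1) := by
  ext; simp

lemma integrand_eq {m : ℕ} (hm : 1 ≤ m) (s lam : ℕ → ℝ) (hpos : ∀ i, i < m → 0 < lam i)
    (μ : Arr (m - 1) m) :
    (Real.exp (∑ l ∈ Icc 1 m,
          s (l - 1) * (asum (min l m) (levT μ lam l) - asum (min (l - 1) m) (levT μ lam (l - 1)))) *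
        ∏ i ∈ range m, levT μ lam m i ^ ((1 / 2 : ℝ) - 1) / lam i ^ ((1 / 2 : ℝ) - 1)) *
      ∏ l ∈ Ico 1 m,
        cross (min l m) (min (l + 1) m) (levT μ lam l) (levT μ lam (l + 1)) ^ ((1 / 2 : ℝ) - 1) /
          (vand (min l m) (levT μ lam l) ^ ((1 / 2 : ℝ) - 1) *
            vand (min (l + 1) m) (levT μ lam (l + 1)) ^ ((1 / 2 : ℝ) - 1)) = gg m s lam μ := by
  have h1 : ∏ i ∈ range m, levT μ lam m i ^ ((1 / 2 : ℝ) - 1) / lam i ^ ((1 / 2 : ℝ) - 1) = 1 := by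
    rw [levT_top (by omega)]
    refine Finset.prod_eq_one fun i hi => ?_
    exact div_self (Real.rpow_pos_of_pos (hpos i (Finset.mem_range.mp hi)) _).ne'
  have h2 : ∑ l ∈ Icc 1 m,
      s (l - 1) * (asum (min l m) (levT μ lam l) - asum (min (l - 1) m) (levT μ lam (l - 1))) =
      ∑ l ∈ range m, s l * (asum (l + 1) (levT μ lam (l + 1)) - asum l (levT μ lam l)) := by
    rw [Icc_one_eq, Finset.sum_Ico_eq_sum_range, Nat.add_sub_cancel]
    refine Finset.sum_congr rfl fun l hl => ?_
    have := Finset.mem_range.mp hl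
    rw [show 1 + l = l + 1 from Nat.add_comm 1 l, Nat.add_sub_cancel, min_eq_left (by omega),
      min_eq_left (by omega)]
  rw [h1, h2, mul_one]
  unfold gg fac
  congr 1
  refine Finset.prod_congr rfl fun l hl => ?_
  have := Finset.mem_Ico.mp hl
  rw [min_eq_left (by omega), min_eq_left (by omega)]

lemma phi_eq {m : ℕ} (hm : 1 ≤ m) (s lam : ℕ → ℝ) (hlam : sdecrPos m lam) :
    phiB (1 / 2) m m lam s =
      (Real.Gamma (1 / 2))⁻¹ ^ (m * (m - 1) / 2 + m * (m - m)) * (JJ m s lam).toReal := by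
  unfold phiB
  congr 1
  simp only [integrand_eq hm s lam hlam.2]
  have hG : MeasurableSet (GTset m m lam) := measurableSet_GT (fun μ => μ) (fun _ => lam)
      measurable_id (fun _ => measurable_const)
  rw [integral_eq_lintegral_of_nonneg_ae]
  · rfl
  · refine (ae_restrict_iff' hG).mpr (Eventually.of_forall fun μ hμ => ?_)
    exact gg_nonneg (fun i j h1 h2 => (hlam.1 i j h1 h2).le) hμ
  · exact (measurable_gg s (fun μ => μ) (fun _ => lam) measurable_id
      (fun _ => measurable_const)).aestronglyMeasurable

lemma KK_eq (m : ℕ) : KK m = gammaProd (1 / 2) m m / Real.Gamma (1 / 2) ^ m *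
    (Real.Gamma (1 / 2))⁻¹ ^ (m * (m - 1) / 2 + m * (m - m)) := by
  unfold KK gammaProd
  rw [Finset.prod_div_distrib, Finset.prod_pow_eq_pow_sum, Finset.sum_add_distrib,
    Finset.sum_range_id, Finset.sum_const, Finset.card_range, smul_eq_mul, mul_one, Nat.sub_self,
    mul_zero, add_zero, inv_pow, pow_add]
  have h : ∏ k ∈ Icc (0 + 1) m, Real.Gamma ((k : ℝ) * (1 / 2)) =
      ∏ k ∈ range m, Real.Gamma (((k : ℝ) + 1) / 2) := by
    rw [Nat.zero_add, Icc_one_eq, Finset.prod_Ico_eq_prod_range, Nat.add_sub_cancel]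
    refine Finset.prod_congr rfl fun l _ => ?_
    congr 1
    push_cast
    ring
  rw [h, div_mul_eq_mul_div, ← div_eq_mul_inv, div_div]

lemma hciz_eq {m : ℕ} (a b : ℕ → ℝ) (ν : Measure (Matrix (Fin m) (Fin m) ℝ)) :
    hcizR m ν a m b m =
      (∫⁻ V, qf (fun l : Fin m => -b l / 2) (fun i : Fin m => a i) V ∂ν).toReal := by
  unfold hcizR
  have key : ∀ V : Matrix (Fin m) (Fin m) ℝ,
      -(Matrix.trace (V * Matrix.diagonal (pad m a m) * V.transpose *
        Matrix.diagonal (pad m b m))) / 2 = ∑ l : Fin m, -b l / 2 * ∑ i : Fin m, a i * V l i ^ 2 := by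
    intro V
    have hp : ∀ (x : ℕ → ℝ) (j : Fin m), pad m x m j = x j := fun x j => by simp [pad]
    simp only [Matrix.trace, Matrix.diag_apply, Matrix.mul_diagonal]
    rw [neg_div, Finset.sum_div, ← Finset.sum_neg_distrib]
    refine Finset.sum_congr rfl fun l _ => ?_
    rw [Matrix.mul_apply, hp]
    have : ∑ j, (V * Matrix.diagonal (pad m a m)) l j * V.transpose j l = ∑ i : Fin m, a i * V l i ^ 2 := by
      refine Finset.sum_congr rfl fun i _ => ?_
      rw [Matrix.mul_diagonal, hp, Matrix.transpose_apply]; ring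
    rw [this]; ring
  simp only [key]
  rw [integral_eq_lintegral_of_nonneg_ae]
  · rfl
  · exact Eventually.of_forall fun V => (Real.exp_pos _).le
  · refine Measurable.aestronglyMeasurable (Real.measurable_exp.comp ?_)
    refine Finset.measurable_sum _ fun l _ => ?_
    refine Measurable.const_mul (Finset.measurable_sum _ fun i _ => ?_) _
    exact Measurable.const_mul ((measurable_entry l i).pow_const 2) _

/-- the real HCIZ integral as a multivariate Bessel function. -/
theorem hciz_real_eq_bessel (m : ℕ) (hm : 1 ≤ m) (a b : ℕ → ℝ) (ha : sdecrPos m a)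
    (ν : Measure (Matrix (Fin m) (Fin m) ℝ)) (hν : IsHaarOrth m ν) :
    hcizR m ν a m b m = mvBessel (1 / 2) m m a fun i => -b i / 2 := by
  have hw : 0 < vand m a ^ ((1 : ℝ) / 2) := Real.rpow_pos_of_pos (vand_pos ha.1) _
  rw [hciz_eq, claim m a (fun i => -b i / 2) ha.1 ν hν, ENNReal.toReal_mul,
    ENNReal.toReal_ofReal (div_nonneg (KK_pos m).le hw.le)]
  unfold mvBessel
  rw [phi_eq hm _ _ ha, KK_eq]
  have : ∏ i ∈ range m, a i ^ ((1 / 2 : ℝ) * ((m - m : ℕ) : ℝ)) = 1 := by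
    refine Finset.prod_eq_one fun i _ => ?_
    simp
  rw [this]
  ring

end RMT
end
end

section
/- Quasi-classical limit of the Macdonald norm constant: fix θ > 0 and reals λ_1 > λ_2 > ⋯ > λ_n > 0, and set λ_{n+1} := 0. For an integer partition ν = (ν_1 ≥ ⋯ ≥ ν_n ≥ 0) define b_ν(q, t) := ∏_{l=1}^n ∏_{i=0}^{l−1} (t^{i+1} q^{ν_{l−i} − ν_l}; q)_{ν_l − ν_{l+1}} / (t^i q^{ν_{l−i} − ν_l + 1}; q)_{ν_l − ν_{l+1}} (with ν_{n+1} := 0). Then lim_{ε→0⁺} ε^{n(θ−1)} b_{⌊ε^{−1}λ⌋}(e^{−ε}, e^{−θε}) = Γ(θ)^{−n} ∏_{i=1}^n (1 − e^{−λ_i})^{θ−1}, where ⌊ε^{−1}λ⌋ denotes the partition with parts ⌊ε^{−1}λ_i⌋. -/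
open MeasureTheory ProbabilityTheory Filter Finset
open scoped ENNReal NNReal BigOperators Classical

noncomputable section

namespace RMT

lemma mvt_unif (g g' : ℝ → ℝ) (a b : ℝ) (hg : ∀ x ∈ Set.Icc a b, HasDerivAt g (g' x) x)
    (hc : ContinuousOn g' (Set.Icc a b)) (η : ℝ) (hη : 0 < η) :
    ∃ r > 0, ∀ x ∈ Set.Icc a b, ∀ y ∈ Set.Icc a b, |y - x| < r →
      |g y - g x - g' x * (y - x)| ≤ η * |y - x| := by
  have hu := isCompact_Icc.uniformContinuousOn_of_continuous hc
  rw [Metric.uniformContinuousOn_iff] at hu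
  obtain ⟨r, hr, h⟩ := hu η hη
  refine ⟨r, hr, fun x hx y hy hxy => ?_⟩
  have hs : Set.uIcc x y ⊆ Set.Icc a b := Set.uIcc_subset_Icc hx hy
  have := (convex_uIcc x y).norm_image_sub_le_of_norm_hasDerivWithin_le
    (f := fun z => g z - g' x * z) (f' := fun z => g' z - g' x) (C := η) (x := x) (y := y)
    (fun z hz => by
      have := (hg z (hs hz)).sub ((hasDerivAt_id z).const_mul (g' x))
      have h2 := this.hasDerivWithinAt (s := Set.uIcc x y)
      rw [mul_one] at h2
      exact h2)
    (fun z hz => by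
      have h1 : |z - x| ≤ |y - x| := Set.abs_sub_left_of_mem_uIcc hz
      have := h z (hs hz) x hx (by rw [Real.dist_eq]; linarith)
      rw [Real.dist_eq] at this
      exact this.le) Set.left_mem_uIcc Set.right_mem_uIcc
  simp only [Real.norm_eq_abs] at this
  convert this using 2
  ring

lemma riemann_lim (g g' : ℝ → ℝ) (a b : ℝ) (hg : ∀ x ∈ Set.Icc a b, HasDerivAt g (g' x) x)
    (hc : ContinuousOn g' (Set.Icc a b)) (δ A B : ℝ) (x0 : ℝ → ℝ) (N : ℝ → ℕ)
    (hA : a < A) (hB : B < b) (hAB : A ≤ B)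
    (h0 : Tendsto x0 (nhdsWithin 0 (Set.Ioi 0)) (nhds A))
    (h1 : Tendsto (fun ε => x0 ε + ε * N ε) (nhdsWithin 0 (Set.Ioi 0)) (nhds B)) :
    Tendsto (fun ε => ∑ k ∈ range (N ε), (g (x0 ε + ε * k + δ * ε) - g (x0 ε + ε * k)))
      (nhdsWithin 0 (Set.Ioi 0)) (nhds (δ * (g B - g A))) := by
  have hmain : Tendsto (fun ε => δ * (g (x0 ε + ε * N ε) - g (x0 ε)))
      (nhdsWithin 0 (Set.Ioi 0)) (nhds (δ * (g B - g A))) := by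
    refine Tendsto.const_mul _ (Tendsto.sub ?_ ?_)
    · exact (hg B ⟨by linarith, hB.le⟩).continuousAt.tendsto.comp h1
    · exact (hg A ⟨hA.le, by linarith⟩).continuousAt.tendsto.comp h0
  suffices hd : Tendsto (fun ε => ∑ k ∈ range (N ε), (g (x0 ε + ε * k + δ * ε) - g (x0 ε + ε * k))
      - δ * (g (x0 ε + ε * N ε) - g (x0 ε))) (nhdsWithin 0 (Set.Ioi 0)) (nhds 0) by
    simpa using hd.add hmain
  rw [Metric.tendsto_nhds]
  intro e he
  have hba : 0 < b - a := by linarith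
  set η := e / (2 * (2 * |δ| + 1) * (b - a)) with hηd
  have hη : 0 < η := by positivity
  obtain ⟨r, hr, hmv⟩ := mvt_unif g g' a b hg hc η hη
  have hid : Tendsto (fun ε : ℝ => ε) (nhdsWithin 0 (Set.Ioi 0)) (nhds 0) := tendsto_nhdsWithin_of_tendsto_nhds tendsto_id
  have e1 : ∀ᶠ ε in nhdsWithin 0 (Set.Ioi 0), a < x0 ε - (|δ| + 1) * ε := by
    have : Tendsto (fun ε => x0 ε - (|δ| + 1) * ε) (nhdsWithin 0 (Set.Ioi 0)) (nhds A) := by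
      simpa using h0.sub (hid.const_mul (|δ| + 1))
    exact this.eventually (lt_mem_nhds hA)
  have e2 : ∀ᶠ ε in nhdsWithin 0 (Set.Ioi 0), x0 ε + ε * N ε + (|δ| + 1) * ε < b := by
    have : Tendsto (fun ε => x0 ε + ε * N ε + (|δ| + 1) * ε) (nhdsWithin 0 (Set.Ioi 0)) (nhds B) := by
      simpa using h1.add (hid.const_mul (|δ| + 1))
    exact this.eventually (gt_mem_nhds hB)
  have e3 : ∀ᶠ ε in nhdsWithin (0:ℝ) (Set.Ioi 0), (|δ| + 1) * ε < r := by
    have : Tendsto (fun ε => (|δ| + 1) * ε) (nhdsWithin 0 (Set.Ioi 0)) (nhds 0) := by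
      simpa using (hid.const_mul (|δ| + 1))
    exact this.eventually (gt_mem_nhds hr)
  filter_upwards [e1, e2, e3, self_mem_nhdsWithin] with ε e1 e2 e3 hε
  have hε : 0 < ε := hε
  have hδ := abs_nonneg δ
  have hδ1 := neg_abs_le δ
  have hδ2 := le_abs_self δ
  have hde1 : -(|δ| * ε) ≤ δ * ε := by nlinarith
  have hde2 : δ * ε ≤ |δ| * ε := by nlinarith
  have hdn : 0 ≤ |δ| * ε := by positivity
  have tele : g (x0 ε + ε * N ε) - g (x0 ε) =
      ∑ k ∈ range (N ε), (g (x0 ε + ε * k + ε) - g (x0 ε + ε * k)) := by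
    have := Finset.sum_range_sub (fun k : ℕ => g (x0 ε + ε * k)) (N ε)
    simp only [Nat.cast_zero, mul_zero, add_zero] at this
    rw [← this]
    refine Finset.sum_congr rfl fun k _ => ?_
    congr 2
    push_cast; ring
  rw [tele, Finset.mul_sum, ← Finset.sum_sub_distrib, Real.dist_eq, sub_zero]
  have hterm : ∀ k ∈ range (N ε), |g (x0 ε + ε * k + δ * ε) - g (x0 ε + ε * k) -
      δ * (g (x0 ε + ε * k + ε) - g (x0 ε + ε * k))| ≤ 2 * |δ| * η * ε := by
    intro k hk
    have hk : (k : ℝ) + 1 ≤ N ε := by exact_mod_cast Finset.mem_range.1 hk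
    have hk0 : 0 ≤ ε * (k : ℝ) := by positivity
    have hkN : ε * k + ε ≤ ε * N ε := by nlinarith
    have hx : x0 ε + ε * k ∈ Set.Icc a b := ⟨by linarith, by linarith⟩
    have p1 := hmv _ hx (x0 ε + ε * k + δ * ε) ⟨by linarith, by linarith⟩ (by
      rw [add_sub_cancel_left, abs_mul, abs_of_pos hε]; linarith)
    have p2 := hmv _ hx (x0 ε + ε * k + ε) ⟨by linarith, by linarith⟩ (by
      rw [add_sub_cancel_left, abs_of_pos hε]; linarith)
    rw [add_sub_cancel_left] at p1 p2
    rw [abs_mul, abs_of_pos hε] at p1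
    rw [abs_of_pos hε] at p2
    generalize hG : g' (x0 ε + ε * k) = G at p1 p2
    calc _ = |(g (x0 ε + ε * k + δ * ε) - g (x0 ε + ε * k) - G * (δ * ε)) -
      δ * (g (x0 ε + ε * k + ε) - g (x0 ε + ε * k) - G * ε)| := by congr 1; ring
      _ ≤ |g (x0 ε + ε * k + δ * ε) - g (x0 ε + ε * k) - G * (δ * ε)| +
        |δ * (g (x0 ε + ε * k + ε) - g (x0 ε + ε * k) - G * ε)| := abs_sub _ _
      _ ≤ η * (|δ| * ε) + |δ| * (η * ε) := by
        rw [abs_mul]; gcongr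
      _ = _ := by ring
  have hNb : ε * N ε ≤ b - a := by nlinarith
  calc _ ≤ ∑ k ∈ range (N ε), 2 * |δ| * η * ε :=
        (Finset.abs_sum_le_sum_abs _ _).trans (Finset.sum_le_sum hterm)
    _ = 2 * |δ| * η * (ε * N ε) := by rw [Finset.sum_const, Finset.card_range, nsmul_eq_mul]; ring
    _ ≤ 2 * |δ| * η * (b - a) := by gcongr
    _ ≤ (2 * |δ| + 1) * η * (b - a) := by gcongr; linarith
    _ = e / 2 := by rw [hηd]; field_simp
    _ < e := by linarith

noncomputable def uu : ℝ → ℝ := dslope (fun x => -Real.exp (-x)) 0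

lemma uu_mul (x : ℝ) : x * uu x = 1 - Real.exp (-x) := by
  have := sub_smul_dslope (fun x => -Real.exp (-x)) 0 x
  simp only [smul_eq_mul, sub_zero, neg_zero, Real.exp_zero] at this
  rw [uu, this]; ring

lemma uu_zero : uu 0 = 1 := by
  rw [uu, dslope_same]
  have : HasDerivAt (fun x : ℝ => -Real.exp (-x)) (-(Real.exp (-0) * (-1))) 0 :=
    ((hasDerivAt_neg (0:ℝ)).exp).neg
  rw [this.deriv]; simp

lemma uu_pos (x : ℝ) : 0 < uu x := by
  rcases lt_trichotomy x 0 with h | h | h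
  · have := uu_mul x
    have h2 : 1 < Real.exp (-x) := Real.one_lt_exp_iff.2 (by linarith)
    by_contra h3
    nlinarith
  · rw [h, uu_zero]; exact one_pos
  · have := uu_mul x
    have h2 : Real.exp (-x) < 1 := Real.exp_lt_one_iff.2 (by linarith)
    by_contra h3
    nlinarith

lemma uu_analytic (x : ℝ) : AnalyticAt ℝ uu x := by
  have hF : ∀ x, AnalyticAt ℝ (fun x : ℝ => -Real.exp (-x)) x := fun x => by fun_prop
  by_cases hx : x = 0
  · subst hx
    obtain ⟨p, hp⟩ := hF 0
    exact ⟨_, hp.has_fpower_series_dslope_fslope⟩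
  · have : AnalyticAt ℝ (fun x => (1 - Real.exp (-x)) / x) x := by
      fun_prop (disch := assumption)
    refine this.congr ?_
    filter_upwards [isOpen_ne.mem_nhds hx] with y hy
    rw [← uu_mul]; field_simp [show y ≠ 0 from hy]

lemma gg_analytic (x : ℝ) : AnalyticAt ℝ (fun x => Real.log (uu x)) x :=
  (uu_analytic x).log (uu_pos x)

lemma exp_lt1 {x : ℝ} (h : 0 < x) : 0 < 1 - Real.exp (-x) := by
  have := Real.exp_lt_one_iff.2 (neg_lt_zero.2 h); linarith

lemma term_pos (θ : ℝ) (hθ : 0 < θ) (i : ℕ) (a N : ℝ → ℕ) (A D : ℝ) (hA : 0 < A) (hD : 0 ≤ D)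
    (ha : Tendsto (fun ε => ε * a ε) (nhdsWithin 0 (Set.Ioi 0)) (nhds A))
    (hN : Tendsto (fun ε => ε * N ε) (nhdsWithin 0 (Set.Ioi 0)) (nhds D)) :
    Tendsto (fun ε => qpoch (Real.exp (-θ * ε) ^ (i + 1) * Real.exp (-ε) ^ (a ε)) (Real.exp (-ε)) (N ε) /
      qpoch (Real.exp (-θ * ε) ^ i * Real.exp (-ε) ^ (a ε + 1)) (Real.exp (-ε)) (N ε))
      (nhdsWithin 0 (Set.Ioi 0))
      (nhds ((1 - Real.exp (-(A + D))) ^ (θ - 1) / (1 - Real.exp (-A)) ^ (θ - 1))) := by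
  have hid : Tendsto (fun ε : ℝ => ε) (nhdsWithin 0 (Set.Ioi 0)) (nhds 0) := tendsto_nhdsWithin_of_tendsto_nhds tendsto_id
  have hx0 : Tendsto (fun ε => ε * a ε + (θ * i + 1) * ε) (nhdsWithin 0 (Set.Ioi 0)) (nhds A) := by
    simpa using ha.add (hid.const_mul (θ * i + 1))
  have han : ∀ x : ℝ, 0 < x → AnalyticAt ℝ (fun x => Real.log (1 - Real.exp (-x))) x := by
    intro x hx
    have : AnalyticAt ℝ (fun x => (1 - Real.exp (-x))) x := by fun_prop
    exact this.log (exp_lt1 hx)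
  have key := riemann_lim (fun x => Real.log (1 - Real.exp (-x))) _ (A / 2) (A + D + 1)
    (fun x hx => (han x (by linarith [hx.1])).differentiableAt.hasDerivAt)
    (fun x hx => (han x (by linarith [hx.1])).deriv.continuousAt.continuousWithinAt)
    (θ - 1) A (A + D) _ N (by linarith) (by linarith) (by linarith) hx0 (hx0.add hN)
  have key2 := (Real.continuous_exp.tendsto _).comp key
  have hlim : Real.exp ((θ - 1) * (Real.log (1 - Real.exp (-(A + D))) - Real.log (1 - Real.exp (-A))))
      = (1 - Real.exp (-(A + D))) ^ (θ - 1) / (1 - Real.exp (-A)) ^ (θ - 1) := by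
    rw [Real.rpow_def_of_pos (exp_lt1 (by linarith)), Real.rpow_def_of_pos (exp_lt1 hA),
      ← Real.exp_sub]
    congr 1; ring
  rw [hlim] at key2
  refine key2.congr' ?_
  filter_upwards [self_mem_nhdsWithin] with ε hε
  have hε : 0 < ε := hε
  simp only [Function.comp, qpoch]
  rw [Real.exp_sum, ← Finset.prod_div_distrib]
  refine Finset.prod_congr rfl fun k _ => ?_
  have hx : 0 < ε * a ε + (θ * i + 1) * ε + ε * k := by positivity
  have hy : 0 < ε * a ε + (θ * i + 1) * ε + ε * k + (θ - 1) * ε := by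
    have : 0 < ε * a ε + (θ * i + θ) * ε + ε * k := by positivity
    linarith
  rw [Real.exp_sub, Real.exp_log (exp_lt1 hx), Real.exp_log (exp_lt1 hy)]
  simp only [← Real.exp_nat_mul, ← Real.exp_add]
  congr 3 <;> · push_cast; ring_nf

lemma gamma_part (θ : ℝ) (hθ : 0 < θ) (N : ℝ → ℕ) (D : ℝ) (hD : 0 < D)
    (hN : Tendsto (fun ε => ε * N ε) (nhdsWithin 0 (Set.Ioi 0)) (nhds D)) :
    Tendsto (fun ε : ℝ => ε ^ (θ - 1) * ∏ k ∈ range (N ε), ((θ + k) / (1 + k)))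
      (nhdsWithin 0 (Set.Ioi 0)) (nhds ((Real.Gamma θ)⁻¹ * D ^ (θ - 1))) := by
  have hinv : Tendsto (fun ε : ℝ => ε⁻¹) (nhdsWithin 0 (Set.Ioi 0)) atTop := tendsto_inv_nhdsGT_zero
  have hNr : Tendsto (fun ε => (N ε : ℝ)) (nhdsWithin 0 (Set.Ioi 0)) atTop := by
    refine (hinv.atTop_mul_pos hD hN).congr' ?_
    filter_upwards [self_mem_nhdsWithin] with ε hε
    have hε : 0 < ε := hε
    field_simp
  have hNn : Tendsto N (nhdsWithin 0 (Set.Ioi 0)) atTop := tendsto_natCast_atTop_iff.1 hNr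
  have hG : Tendsto (fun ε => (Real.GammaSeq θ (N ε))⁻¹) (nhdsWithin 0 (Set.Ioi 0))
      (nhds (Real.Gamma θ)⁻¹) :=
    ((Real.GammaSeq_tendsto_Gamma θ).comp hNn).inv₀ (Real.Gamma_pos_of_pos hθ).ne'
  have hpow : Tendsto (fun ε => (ε * N ε) ^ (θ - 1)) (nhdsWithin 0 (Set.Ioi 0)) (nhds (D ^ (θ - 1))) :=
    hN.rpow_const (Or.inl hD.ne')
  have hr : Tendsto (fun ε => (1 + θ * (N ε : ℝ)⁻¹)⁻¹) (nhdsWithin 0 (Set.Ioi 0)) (nhds 1) := by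
    have : Tendsto (fun ε => (1 + θ * (N ε : ℝ)⁻¹)) (nhdsWithin 0 (Set.Ioi 0)) (nhds 1) := by
      simpa using (hNr.inv_tendsto_atTop.const_mul θ).const_add 1
    simpa using this.inv₀ one_ne_zero
  have := (hG.mul hpow).mul hr
  rw [mul_one] at this
  refine this.congr' ?_
  filter_upwards [self_mem_nhdsWithin, hNn.eventually_ge_atTop 1] with ε hε hN1
  have hε : 0 < ε := hε
  generalize N ε = M at hN1
  have hM : (0:ℝ) < M := by exact_mod_cast hN1
  rw [Real.GammaSeq, Finset.prod_div_distrib, Finset.prod_range_succ]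
  have hf : ∏ k ∈ range M, (1 + (k:ℝ)) = M.factorial := by
    rw [← Finset.prod_range_add_one_eq_factorial]; push_cast
    exact Finset.prod_congr rfl fun k _ => add_comm _ _
  rw [hf, Real.mul_rpow hε.le hM.le, Real.rpow_sub_one hM.ne']
  have h1 : (0:ℝ) < M ^ θ := Real.rpow_pos_of_pos hM _
  have h2 : (0:ℝ) < M.factorial := by exact_mod_cast M.factorial_pos
  have h3 : (1 + θ * (M:ℝ)⁻¹)  = (θ + M) / M := by field_simp; ring
  have h4 : 0 < θ + M := by positivity
  rw [h3]
  field_simp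

lemma term_zero (θ : ℝ) (hθ : 0 < θ) (N : ℝ → ℕ) (D : ℝ) (hD : 0 < D)
    (hN : Tendsto (fun ε => ε * N ε) (nhdsWithin 0 (Set.Ioi 0)) (nhds D)) :
    Tendsto (fun ε => ε ^ (θ - 1) * (qpoch (Real.exp (-θ * ε)) (Real.exp (-ε)) (N ε) /
      qpoch (Real.exp (-ε)) (Real.exp (-ε)) (N ε)))
      (nhdsWithin 0 (Set.Ioi 0))
      (nhds ((Real.Gamma θ)⁻¹ * (1 - Real.exp (-D)) ^ (θ - 1))) := by
  have hid : Tendsto (fun ε : ℝ => ε) (nhdsWithin 0 (Set.Ioi 0)) (nhds 0) := tendsto_nhdsWithin_of_tendsto_nhds tendsto_id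
  have h1 : Tendsto (fun ε => ε + ε * N ε) (nhdsWithin 0 (Set.Ioi 0)) (nhds D) := by
    simpa using hid.add hN
  have key := riemann_lim (fun x => Real.log (uu x)) _ (-1) (D + 1)
    (fun x hx => (gg_analytic x).differentiableAt.hasDerivAt)
    (fun x hx => (gg_analytic x).deriv.continuousAt.continuousWithinAt)
    (θ - 1) 0 D _ N (by linarith) (by linarith) (by linarith) hid h1
  have key2 := ((Real.continuous_exp.tendsto _).comp key).mul (gamma_part θ hθ N D hD hN)
  have hlim : Real.exp ((θ - 1) * (Real.log (uu D) - Real.log (uu 0))) *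
      ((Real.Gamma θ)⁻¹ * D ^ (θ - 1)) = (Real.Gamma θ)⁻¹ * (1 - Real.exp (-D)) ^ (θ - 1) := by
    rw [uu_zero, Real.log_one, sub_zero, ← uu_mul D, Real.mul_rpow hD.le (uu_pos D).le,
      Real.rpow_def_of_pos (uu_pos D), mul_comm (θ - 1)]
    ring
  rw [hlim] at key2
  refine key2.congr' ?_
  filter_upwards [self_mem_nhdsWithin] with ε hε
  have hε : 0 < ε := hε
  simp only [Function.comp, qpoch]
  rw [Real.exp_sum, mul_left_comm, ← Finset.prod_div_distrib, ← Finset.prod_mul_distrib]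
  congr 1
  refine Finset.prod_congr rfl fun k _ => ?_
  rw [Real.exp_sub, Real.exp_log (uu_pos _), Real.exp_log (uu_pos _)]
  simp only [← Real.exp_nat_mul, ← Real.exp_add]
  have e1 : -θ * ε + k * -ε = -(ε + ε * k + (θ - 1) * ε) := by ring
  have e2 : -ε + k * -ε = -(ε + ε * k) := by ring
  rw [e1, e2, ← uu_mul, ← uu_mul]
  have := uu_pos (ε + ε * k)
  have e3 : ε + ε * k + (θ - 1) * ε = ε * (θ + k) := by ring
  have e4 : ε + ε * k = ε * (1 + k) := by ring
  rw [e3]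
  rw [e4] at this ⊢
  have h5 : (0:ℝ) < 1 + k := by positivity
  field_simp

lemma prod_Icc_shift (f : ℕ → ℝ) (n : ℕ) : ∏ l ∈ Icc 1 n, f l = ∏ l ∈ range n, f (l + 1) := by
  rw [Finset.range_eq_Ico, Finset.prod_Ico_add' f 0 n 1]
  rfl

lemma floor_lim (c : ℝ) (hc : 0 ≤ c) :
    Tendsto (fun ε : ℝ => ε * (⌊ε⁻¹ * c⌋₊ : ℝ)) (nhdsWithin 0 (Set.Ioi 0)) (nhds c) := by
  have hinv : Tendsto (fun ε : ℝ => ε⁻¹) (nhdsWithin 0 (Set.Ioi 0)) atTop := tendsto_inv_nhdsGT_zero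
  refine ((tendsto_nat_floor_mul_div_atTop hc).comp hinv).congr fun ε => ?_
  simp only [Function.comp, div_inv_eq_mul]
  rw [mul_comm c, mul_comm]

lemma tele_prod (G : ℝ) (F : ℕ → ℕ → ℝ) (n : ℕ) (hF : ∀ j l, j < l → l < n → F (j + 1) (l + 1) ≠ 0) :
    ∏ l ∈ range n, ((∏ i ∈ range l, F (l - i) (l + 2) / F (l - i) (l + 1)) * (G * F (l + 1) (l + 2)))
      = G ^ n * ∏ j ∈ range n, F (j + 1) (n + 1) := by
  induction n with
  | zero => simp
  | succ m ih =>
    rw [Finset.prod_range_succ, ih fun j l h1 h2 => hF j l h1 (by omega)]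
    have hr : ∏ i ∈ range m, F (m - i) (m + 2) / F (m - i) (m + 1) =
        ∏ j ∈ range m, F (j + 1) (m + 2) / F (j + 1) (m + 1) := by
      rw [← Finset.prod_range_reflect]
      refine Finset.prod_congr rfl fun j hj => ?_
      have := Finset.mem_range.1 hj
      rw [show m - (m - 1 - j) = j + 1 by omega]
    have hne : ∏ j ∈ range m, F (j + 1) (m + 1) ≠ 0 :=
      Finset.prod_ne_zero_iff.2 fun j hj => hF j m (Finset.mem_range.1 hj) (by omega)
    rw [hr, Finset.prod_div_distrib, Finset.prod_range_succ (fun j => F (j + 1) (m + 1 + 1))]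
    field_simp
    ring

/-- quasi-classical limit of the Macdonald norm constant. -/
theorem bMac_limit (θ : ℝ) (hθ : 0 < θ) (n : ℕ) (hn : 1 ≤ n) (lam : ℕ → ℝ)
    (hlam : sdecrPos n lam) :
    Tendsto (fun ε : ℝ => ε ^ ((n : ℝ) * (θ - 1)) *
        bMac n (fun l => if 1 ≤ l ∧ l ≤ n then ⌊ε⁻¹ * lam (l - 1)⌋₊ else 0)
          (Real.exp (-ε)) (Real.exp (-θ * ε)))
      (nhdsWithin 0 (Set.Ioi 0))
      (nhds ((Real.Gamma θ)⁻¹ ^ n * ∏ i ∈ range n, (1 - Real.exp (-lam i)) ^ (θ - 1))) := by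
  obtain ⟨hdec, hpos⟩ := hlam
  set L : ℕ → ℝ := fun m => if 1 ≤ m ∧ m ≤ n then lam (m - 1) else 0 with hL
  set ν : ℝ → ℕ → ℕ := fun ε l => if 1 ≤ l ∧ l ≤ n then ⌊ε⁻¹ * lam (l - 1)⌋₊ else 0 with hν
  have hνL : ∀ ε l, ν ε l = ⌊ε⁻¹ * L l⌋₊ := by
    intro ε l
    simp only [hν, hL]
    split_ifs <;> simp
  have hL0 : ∀ m, 0 ≤ L m := by
    intro m
    simp only [hL]
    split_ifs with h
    · exact (hpos _ (by omega)).le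
    · exact le_rfl
  have hLlt : ∀ j m, 1 ≤ j → j ≤ n → j < m → L m < L j := by
    intro j m h1 h2 h3
    simp only [hL]
    rw [if_pos (show 1 ≤ j ∧ j ≤ n from ⟨h1, h2⟩)]
    split_ifs with h
    · exact hdec _ _ (by omega) (by omega)
    · exact hpos _ (by omega)
  have hsub : ∀ j m, L m ≤ L j → Tendsto (fun ε : ℝ => ε * ((ν ε j - ν ε m : ℕ) : ℝ))
      (nhdsWithin 0 (Set.Ioi 0)) (nhds (L j - L m)) := by
    intro j m h
    refine ((floor_lim _ (hL0 j)).sub (floor_lim _ (hL0 m))).congr' ?_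
    filter_upwards [self_mem_nhdsWithin] with ε hε
    have hε : 0 < ε := hε
    have : ν ε m ≤ ν ε j := by
      rw [hνL, hνL]; exact Nat.floor_le_floor (by gcongr)
    rw [Nat.cast_sub this, hνL, hνL]; ring
  set F : ℕ → ℕ → ℝ := fun j m => (1 - Real.exp (-(L j - L m))) ^ (θ - 1) with hF
  have hlimit : (Real.Gamma θ)⁻¹ ^ n * ∏ i ∈ range n, (1 - Real.exp (-lam i)) ^ (θ - 1) =
      ∏ l ∈ range n, ((∏ i ∈ range l, F (l - i) (l + 2) / F (l - i) (l + 1)) *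
        ((Real.Gamma θ)⁻¹ * F (l + 1) (l + 2))) := by
    rw [tele_prod]
    · congr 1
      refine Finset.prod_congr rfl fun j hj => ?_
      have hj := Finset.mem_range.1 hj
      have a1 : L (j + 1) = lam j := by
        simp only [hL]; rw [if_pos ⟨by omega, by omega⟩]; rfl
      have a2 : L (n + 1) = 0 := by
        simp only [hL]; rw [if_neg (by omega)]
      simp only [hF, a1, a2, sub_zero]
    · intro j l h1 h2
      exact (Real.rpow_pos_of_pos (exp_lt1 (sub_pos.2 (hLlt _ _ (by omega) (by omega) (by omega)))) _).ne'
  rw [hlimit]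
  have hrow : ∀ l ∈ range n, Tendsto (fun ε : ℝ =>
      (∏ i ∈ range l, qpoch (Real.exp (-θ * ε) ^ (i + 1 + 1) *
            Real.exp (-ε) ^ (ν ε (l - i) - ν ε (l + 1))) (Real.exp (-ε)) (ν ε (l + 1) - ν ε (l + 2)) /
          qpoch (Real.exp (-θ * ε) ^ (i + 1) *
            Real.exp (-ε) ^ (ν ε (l - i) - ν ε (l + 1) + 1)) (Real.exp (-ε))
              (ν ε (l + 1) - ν ε (l + 2))) *
        (ε ^ (θ - 1) * (qpoch (Real.exp (-θ * ε)) (Real.exp (-ε)) (ν ε (l + 1) - ν ε (l + 2)) /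
          qpoch (Real.exp (-ε)) (Real.exp (-ε)) (ν ε (l + 1) - ν ε (l + 2)))))
      (nhdsWithin 0 (Set.Ioi 0))
      (nhds ((∏ i ∈ range l, F (l - i) (l + 2) / F (l - i) (l + 1)) *
        ((Real.Gamma θ)⁻¹ * F (l + 1) (l + 2)))) := by
    intro l hl
    have hl := Finset.mem_range.1 hl
    have hD := hLlt (l + 1) (l + 2) (by omega) (by omega) (by omega)
    refine Tendsto.mul (tendsto_finsetProd _ fun i hi => ?_) ?_
    · have hi := Finset.mem_range.1 hi
      have hA := hLlt (l - i) (l + 1) (by omega) (by omega) (by omega)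
      have := term_pos θ hθ (i + 1) _ _ _ _ (sub_pos.2 hA) (sub_pos.2 hD).le
        (hsub (l - i) (l + 1) hA.le) (hsub (l + 1) (l + 2) hD.le)
      rw [sub_add_sub_cancel] at this
      exact this
    · exact term_zero θ hθ _ _ (sub_pos.2 hD) (hsub (l + 1) (l + 2) hD.le)
  refine (tendsto_finsetProd _ hrow).congr' ?_
  filter_upwards [self_mem_nhdsWithin] with ε hε
  have hε : 0 < ε := hε
  have hpow : ε ^ ((n : ℝ) * (θ - 1)) = ∏ l ∈ range n, ε ^ (θ - 1) := by
    rw [Finset.prod_const, Finset.card_range, mul_comm, Real.rpow_mul hε.le, Real.rpow_natCast]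
  rw [bMac, hpow, prod_Icc_shift, ← Finset.prod_mul_distrib]
  refine Finset.prod_congr rfl fun l _ => ?_
  rw [Finset.prod_range_succ']
  simp only [Nat.add_sub_add_right, Nat.sub_zero, Nat.sub_self, zero_add, pow_zero, pow_one,
    mul_one, one_mul]
  exact mul_left_comm _ _ _

end RMT
end
end
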